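/- Suppose d' = d and d is odd. Set p* = (−1)^{(p−1)/2} p and let √(p*) = √p if p ≡ 1 (mod 4) and i√p if p ≡ 3 (mod 4); let (·/p) be the Legendre symbol. Then, as (α,β,γ) ranges over F_{p^m} × F_q × F_q, the value S(α,β,γ) equals: p^m for exactly p^{m+d−1}(p^m+1)(p^m+p−1)(p^n−1)/(2(p^d+1)) triples; −p^m for exactly p^{m+d−1}(p^m−1)(p^m−p+1)(p^n−2p^{n−d}+1)/(2(p^d−1)) triples; for each j with 1 ≤ j ≤ p−1: ζ_p^j·p^m for exactly p^{m+d−1}(p^n−1)^2/(2(p^d+1)) triples, and −ζ_p^j·p^m for exactly p^{m+d−1}(p^n−1)(p^n−2p^{n−d}+1)/(2(p^d−1)) triples; for each ε ∈ {1,−1}: ε√(p*)·p^{m+(d−1)/2} for exactly (1/2)p^{3m−2d−1}(p^n−1) triples, and for each j with 1 ≤ j ≤ p−1, ε·ζ_p^j·√(p*)·p^{m+(d−1)/2} for exactly (1/2)p^{n−(3d+1)/2}(p^{m−(d+1)/2}+ε·(−j/p))(p^n−1) triples; −p^{m+d} for exactly p^{m−d−1}(p^{m−d}−1)(p^n−1)(p^{m−d}−p+1)/(p^{2d}−1)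 triples; for each j with 1 ≤ j ≤ p−1, −ζ_p^j·p^{m+d} for exactly p^{m−d−1}(p^{n−2d}−1)(p^n−1)/(p^{2d}−1) triples; 0 for exactly (p^n−1)(p^{3m−d}−p^{3m−2d}+p^{3m−3d}−p^{n−2d}+1) triples; and p^n for exactly 1 triple; S takes no other values. -/

import Mathlib

open scoped BigOperators Classical

noncomputable section

/-- The map `φ_{α,β}(x) = α x^{p^m} + β x^{p^k} + β^{p^{n-k}} x^{p^{n-k}}`. -/
def phiMap (p m n k : ℕ) {F : Type} [Field F] (α β x : F) : F :=
  α * x ^ p ^ m + β * x ^ p ^ k + β ^ p ^ (n - k) * x ^ p ^ (n - k)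

/-- The trace-type sum `x ↦ ∑_{i<r} x^{p^{t i}}`; for `x` in the subfield of size
`p^{t·r}` this is the relative trace down to the subfield of size `p^t`. -/
def trSum (p t r : ℕ) {F : Type} [Field F] (x : F) : F :=
  ∑ i ∈ Finset.range r, x ^ p ^ (t * i)

/-- `ζ_p^c = exp(2πi·c̃/p)` for a lift `c̃` of `c : F_p`. -/
noncomputable def expChar (p : ℕ) (c : ZMod p) : ℂ :=
  Complex.exp (2 * Real.pi * Complex.I * (c.val : ℂ) / (p : ℂ))

/-- Identify an element of the prime field of `F` with an element of `ZMod p`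
(the partial inverse of the algebra map). -/
noncomputable def fToZMod (p : ℕ) {F : Type} [Field F] [Algebra (ZMod p) F] (x : F) : ZMod p :=
  letI : Nonempty (ZMod p) := ⟨0⟩
  Function.invFun (algebraMap (ZMod p) F) x

/-- `T(α,β) = ∑_{x ∈ F_q} ζ_p^{Tr^m_1(α x^{p^m+1}) + Tr^n_1(β x^{p^k+1})}`. -/
noncomputable def Tsum (p m n k : ℕ) (F : Type) [Field F] [Fintype F] [Algebra (ZMod p) F]
    (α β : F) : ℂ :=
  ∑ x : F, expChar p (fToZMod p (trSum p 1 m (α * x ^ (p ^ m + 1))) +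
      fToZMod p (trSum p 1 n (β * x ^ (p ^ k + 1))))

/-- `S(α,β,γ) = ∑_{x ∈ F_q} ζ_p^{Tr^m_1(α x^{p^m+1}) + Tr^n_1(β x^{p^k+1} + γ x)}`. -/
noncomputable def Ssum (p m n k : ℕ) (F : Type) [Field F] [Fintype F] [Algebra (ZMod p) F]
    (α β γ : F) : ℂ :=
  ∑ x : F, expChar p (fToZMod p (trSum p 1 m (α * x ^ (p ^ m + 1))) +
      fToZMod p (trSum p 1 n (β * x ^ (p ^ k + 1) + γ * x)))

/-- `√(q₀*)` where `q₀* = (−1)^{(q₀−1)/2} q₀`. -/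
noncomputable def sqrtStar (q0 : ℕ) : ℂ :=
  if q0 % 4 = 1 then (Real.sqrt q0 : ℂ) else Complex.I * (Real.sqrt q0 : ℂ)

/-- `ζ_p = exp(2πi/p)`. -/
noncomputable def zetaC (p : ℕ) : ℂ := Complex.exp (2 * Real.pi * Complex.I / (p : ℂ))

/-- Number of pairs `(α,β) ∈ F_{p^m} × F_q` with `T(α,β) = v`. -/
noncomputable def Tcount (p m n k : ℕ) (F : Type) [Field F] [Fintype F] [Algebra (ZMod p) F]
    (v : ℂ) : ℕ :=
  Nat.card {ab : F × F // ab.1 ^ p ^ m = ab.1 ∧ Tsum p m n k F ab.1 ab.2 = v}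

/-- Number of triples `(α,β,γ) ∈ F_{p^m} × F_q × F_q` with `S(α,β,γ) = v`. -/
noncomputable def Scount (p m n k : ℕ) (F : Type) [Field F] [Fintype F] [Algebra (ZMod p) F]
    (v : ℂ) : ℕ :=
  Nat.card {abc : F × F × F // abc.1 ^ p ^ m = abc.1 ∧ Ssum p m n k F abc.1 abc.2.1 abc.2.2 = v}

/-- Hamming weight of the codeword of `C₁` attached to `(α,β)`:
the number of `0 ≤ i ≤ q-2` with `Tr^m_t(α π^{i(p^m+1)}) + Tr^n_t(β π^{i(p^k+1)}) ≠ 0`. -/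
noncomputable def wt1 (p m n k t : ℕ) {F : Type} [Field F] (π α β : F) : ℕ :=
  Nat.card {i : ℕ // i ≤ p ^ n - 2 ∧
    trSum p t (m / t) (α * π ^ (i * (p ^ m + 1))) +
    trSum p t (n / t) (β * π ^ (i * (p ^ k + 1))) ≠ 0}

/-- Number of pairs `(α,β) ∈ F_{p^m} × F_q` whose `C₁`-codeword has weight `v`. -/
noncomputable def wt1count (p m n k t : ℕ) (F : Type) [Field F] [Fintype F] (π : F) (v : ℕ) : ℕ :=
  Nat.card {ab : F × F // ab.1 ^ p ^ m = ab.1 ∧ wt1 p m n k t π ab.1 ab.2 = v}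

/-- Hamming weight of the codeword of `C₂` attached to `(α,β,γ)`. -/
noncomputable def wt2 (p m n k t : ℕ) {F : Type} [Field F] (π α β γ : F) : ℕ :=
  Nat.card {i : ℕ // i ≤ p ^ n - 2 ∧
    trSum p t (m / t) (α * π ^ (i * (p ^ m + 1))) +
    trSum p t (n / t) (β * π ^ (i * (p ^ k + 1)) + γ * π ^ i) ≠ 0}

/-- Number of triples `(α,β,γ)` whose `C₂`-codeword has weight `v`. -/
noncomputable def wt2count (p m n k t : ℕ) (F : Type) [Field F] [Fintype F] (π : F) (v : ℕ) : ℕ :=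
  Nat.card {abc : F × F × F // abc.1 ^ p ^ m = abc.1 ∧ wt2 p m n k t π abc.1 abc.2.1 abc.2.2 = v}

/-- The Gaussian binomial coefficient `[n, j]_q`, by the Pascal rule. -/
def qBinom (q : ℂ) : ℕ → ℕ → ℂ
  | _, 0 => 1
  | 0, _ + 1 => 0
  | n + 1, j + 1 => qBinom q n (j + 1) + q ^ (n - j) * qBinom q n j

theorem qBinom_zero_right (q : ℂ) (n : ℕ) : qBinom q n 0 = 1 := by
  cases n <;> rfl

theorem qBinom_of_lt (q : ℂ) {n j : ℕ} (h : n < j) : qBinom q n j = 0 := by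
  induction n generalizing j with
  | zero => cases j with
    | zero => omega
    | succ j => rfl
  | succ n ih => cases j with
    | zero => omega
    | succ j => simp [qBinom, ih (show n < j + 1 by omega), ih (show n < j by omega)]

theorem qBinom_succ_left_of_ratio (q : ℂ) {n : ℕ}
    (H : ∀ j ≤ n, (1 - q ^ (n - j)) * qBinom q n j = (1 - q ^ (j + 1)) * qBinom q n (j + 1))
    {j : ℕ} (hj : j ≤ n + 1) :
    (1 - q ^ (n + 1 - j)) * qBinom q (n + 1) j = (1 - q ^ (n + 1)) * qBinom q n j := by
  cases j with
  | zero => simp [qBinom_zero_right]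
  | succ j =>
    have h1 := H j (by omega)
    have h2 : q ^ (n + 1) = q ^ (n - j) * q ^ (j + 1) := by
      rw [← pow_add]; congr 1; omega
    rw [show n + 1 - (j + 1) = n - j by omega, qBinom, h2]
    linear_combination q ^ (n - j) * h1

theorem qBinom_ratio (q : ℂ) (n : ℕ) : ∀ j ≤ n,
    (1 - q ^ (n - j)) * qBinom q n j = (1 - q ^ (j + 1)) * qBinom q n (j + 1) := by
  induction n with
  | zero =>
    intro j hj
    obtain rfl : j = 0 := by omega
    simp [qBinom]
  | succ n ih =>
    intro j hj
    rw [qBinom_succ_left_of_ratio q ih hj]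
    rcases Nat.lt_or_ge n j with h | h
    · rw [qBinom_of_lt q h, qBinom_of_lt q (show n + 1 < j + 1 by omega)]; simp
    · have h1 := ih j h
      have h2 : q ^ (n + 1) = q ^ (n - j) * q ^ (j + 1) := by
        rw [← pow_add]; congr 1; omega
      rw [qBinom, h2]
      linear_combination h1

theorem sum_alternating_qBinom_succ_succ (q : ℂ) (n : ℕ) :
    ∑ j ∈ Finset.range (n + 3), (-1) ^ j * qBinom q (n + 2) j =
      (1 - q ^ (n + 1)) * ∑ j ∈ Finset.range (n + 1), (-1) ^ j * qBinom q n j := by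
  have h1 : ∑ j ∈ Finset.range (n + 2), (-1 : ℂ) ^ j * qBinom q (n + 1) j =
      ∑ j ∈ Finset.range (n + 2), (-1 : ℂ) ^ (j + 1) * qBinom q (n + 1) (j + 1) + 1 := by
    have := Finset.sum_range_succ' (fun j => (-1 : ℂ) ^ j * qBinom q (n + 1) j) (n + 2)
    rw [Finset.sum_range_succ, qBinom_of_lt q (show n + 1 < n + 2 by omega)] at this
    simpa [qBinom_zero_right] using this
  have pascal : ∀ j, qBinom q (n + 2) (j + 1) =
      qBinom q (n + 1) (j + 1) + q ^ (n + 1 - j) * qBinom q (n + 1) j := fun _ => rfl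
  rw [Finset.sum_range_succ']
  simp only [pascal, qBinom_zero_right, mul_add, Finset.sum_add_distrib, pow_zero, mul_one]
  have h2 : ∑ j ∈ Finset.range (n + 2), (-1 : ℂ) ^ j * ((1 - q ^ (n + 1 - j)) * qBinom q (n + 1) j)
      = (1 - q ^ (n + 1)) * ∑ j ∈ Finset.range (n + 1), (-1) ^ j * qBinom q n j := by
    rw [Finset.sum_congr rfl fun j hj => by
      rw [qBinom_succ_left_of_ratio q (qBinom_ratio q n)
        (show j ≤ n + 1 by have := Finset.mem_range.1 hj; omega)],
      Finset.sum_range_succ, qBinom_of_lt q (show n < n + 1 by omega), Finset.mul_sum]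
    simp only [mul_zero, add_zero]
    exact Finset.sum_congr rfl fun _ _ => by ring
  rw [← h2]
  have h3 : ∑ j ∈ Finset.range (n + 2), (-1 : ℂ) ^ j * ((1 - q ^ (n + 1 - j)) * qBinom q (n + 1) j)
      = ∑ j ∈ Finset.range (n + 2), (-1 : ℂ) ^ j * qBinom q (n + 1) j +
        ∑ j ∈ Finset.range (n + 2), (-1 : ℂ) ^ (j + 1) *
          (q ^ (n + 1 - j) * qBinom q (n + 1) j) := by
    rw [← Finset.sum_add_distrib]
    exact Finset.sum_congr rfl fun _ _ => by ring
  rw [h3, h1]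
  ring

theorem sum_alternating_qBinom_two_mul (q : ℂ) (h : ℕ) :
    ∑ j ∈ Finset.range (2 * h + 1), (-1) ^ j * qBinom q (2 * h) j =
      ∏ j ∈ Finset.range h, (1 - q ^ (2 * j + 1)) := by
  induction h with
  | zero => simp [qBinom]
  | succ h ih =>
    rw [show 2 * (h + 1) + 1 = 2 * h + 3 by ring, show 2 * (h + 1) = 2 * h + 2 by ring,
      sum_alternating_qBinom_succ_succ, ih, Finset.prod_range_succ, mul_comm]

theorem qBinom_at_root_of_unity {h : ℕ} {z : ℂ} (hz : IsPrimitiveRoot z (2 * h + 1)) {j : ℕ}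
    (hj : j ≤ 2 * h) :
    qBinom (z⁻¹ ^ 2) (2 * h) j = (-1) ^ j * z ^ (j * (j + 1)) := by
  have hz0 : z ≠ 0 := hz.ne_zero (by omega)
  induction j with
  | zero => simp [qBinom_zero_right]
  | succ j ih =>
    have h1 := qBinom_ratio (z⁻¹ ^ 2) (2 * h) j (by omega)
    have hne : z ^ (2 * (j + 1)) ≠ 1 := by
      intro h0
      have hd := (hz.pow_eq_one_iff_dvd _).1 h0
      have hd2 : 2 * h + 1 ∣ j + 1 :=
        Nat.Coprime.dvd_of_dvd_mul_left (by rw [Nat.coprime_comm]; simp) hd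
      have := Nat.le_of_dvd (by omega) hd2
      omega
    have hE : (z⁻¹ ^ 2) ^ (2 * h - j) = z ^ (2 * (j + 1)) := by
      rw [← pow_mul, inv_pow, inv_eq_iff_eq_inv, eq_comm, inv_eq_iff_eq_inv,
        eq_comm, inv_eq_of_mul_eq_one_right]
      rw [← pow_add, show 2 * (2 * h - j) + 2 * (j + 1) = (2 * h + 1) * 2 by omega, pow_mul,
        hz.pow_eq_one, one_pow]
    have hE2 : (z⁻¹ ^ 2) ^ (j + 1) = (z ^ (2 * (j + 1)))⁻¹ := by
      rw [← pow_mul, inv_pow]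
    rw [hE, hE2, ih (by omega)] at h1
    set u := z ^ (2 * (j + 1)) with hu
    have hu0 : u ≠ 0 := pow_ne_zero _ hz0
    have hu1 : u - 1 ≠ 0 := sub_ne_zero.2 hne
    have h3 : z ^ ((j + 1) * (j + 1 + 1)) = z ^ (j * (j + 1)) * u := by
      rw [hu, ← pow_add]; congr 1; ring
    rw [h3]
    have h4 : (u - 1) * qBinom (z⁻¹ ^ 2) (2 * h) (j + 1) =
        (u - 1) * ((-1) ^ (j + 1) * (z ^ (j * (j + 1)) * u)) := by
      have : (u - 1) = u * (1 - u⁻¹) := by field_simp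
      rw [this, mul_assoc, ← h1, ← this]; ring
    exact mul_left_cancel₀ hu1 h4

theorem sum_pow_sq_eq_prod {h : ℕ} {z : ℂ} (hz : IsPrimitiveRoot z (2 * h + 1)) :
    ∑ j ∈ Finset.range (2 * h + 1), z ^ ((j + h + 1) ^ 2) =
      ∏ j ∈ Finset.range h, (z ^ (2 * j + 1) - z⁻¹ ^ (2 * j + 1)) := by
  have hz0 : z ≠ 0 := hz.ne_zero (by omega)
  have h1 := sum_alternating_qBinom_two_mul (z⁻¹ ^ 2) h
  rw [Finset.sum_congr rfl fun j hj => by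
    rw [qBinom_at_root_of_unity hz (show j ≤ 2 * h by have := Finset.mem_range.1 hj; omega),
      ← mul_assoc, ← mul_pow, neg_one_mul, neg_neg, one_pow, one_mul]] at h1
  have hodd : ∏ j ∈ Finset.range h, z ^ (2 * j + 1) = z ^ (h ^ 2) := by
    rw [Finset.prod_pow_eq_pow_sum]
    congr 1
    clear h1 hz
    induction h with
    | zero => rfl
    | succ h ih => rw [Finset.sum_range_succ, ih]; ring
  have h2 : ∀ j ∈ Finset.range (2 * h + 1),
      z ^ ((j + h + 1) ^ 2) = z ^ (h ^ 2) * z ^ (j * (j + 1)) := fun j _ => by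
    rw [← pow_add, show (j + h + 1) ^ 2 = h ^ 2 + j * (j + 1) + (2 * h + 1) * (j + 1) by ring,
      pow_add _ _ ((2 * h + 1) * (j + 1)), pow_mul, hz.pow_eq_one, one_pow, mul_one]
  rw [Finset.sum_congr rfl h2, ← Finset.mul_sum, h1, ← hodd, ← Finset.prod_mul_distrib]
  refine Finset.prod_congr rfl fun j _ => ?_
  rw [mul_sub, mul_one, pow_right_comm, sq, ← mul_assoc, ← mul_pow, mul_inv_cancel₀ hz0, one_pow,
    one_mul]

theorem expChar_eq_stdAddChar (p : ℕ) [NeZero p] (c : ZMod p) :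
    expChar p c = ZMod.stdAddChar c := by
  rw [ZMod.stdAddChar_apply, ZMod.toCircle_apply, expChar]

theorem stdAddChar_natCast (p : ℕ) [NeZero p] (j : ℕ) :
    ZMod.stdAddChar (j : ZMod p) = zetaC p ^ j := by
  have h1 : ZMod.stdAddChar (1 : ZMod p) = zetaC p := by
    have := ZMod.stdAddChar_coe (N := p) 1
    simpa [zetaC] using this
  rw [← h1, ← AddChar.map_nsmul_eq_pow, nsmul_one]

theorem zetaC_isPrimitiveRoot (p : ℕ) [NeZero p] : IsPrimitiveRoot (zetaC p) p :=
  Complex.isPrimitiveRoot_exp p (NeZero.ne p)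

theorem sum_range_natCast_zmod {M : Type*} [AddCommMonoid M] (p : ℕ) [NeZero p] (f : ZMod p → M) :
    ∑ j ∈ Finset.range p, f j = ∑ x, f x := by
  refine Finset.sum_bij' (fun j _ => (j : ZMod p)) (fun x _ => x.val) ?_ ?_ ?_ ?_ ?_
  · simp
  · intro x _; exact Finset.mem_range.2 (ZMod.val_lt x)
  · intro j hj; exact ZMod.val_cast_of_lt (Finset.mem_range.1 hj)
  · intro x _; simp
  · simp

theorem zetaC_pow_sub_inv_pow (p j : ℕ) :
    zetaC p ^ j - (zetaC p)⁻¹ ^ j = Complex.I * (2 * Real.sin (2 * Real.pi * j / p) : ℝ) := by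
  rw [zetaC, ← Complex.exp_neg, ← Complex.exp_nat_mul, ← Complex.exp_nat_mul]
  push_cast
  rw [Complex.sin]
  ring_nf
  rw [Complex.I_sq]
  ring_nf

theorem quadGaussSum_eq_prod {p h : ℕ} [NeZero p] (hp : p = 2 * h + 1) :
    ∑ x : ZMod p, ZMod.stdAddChar (x ^ 2) =
      Complex.I ^ h * (∏ j ∈ Finset.range h,
        (2 * Real.sin (2 * Real.pi * (2 * j + 1 : ℕ) / p)) : ℝ) := by
  have hz := zetaC_isPrimitiveRoot p
  rw [← Equiv.sum_comp (Equiv.addRight ((h + 1 : ℕ) : ZMod p)), ← sum_range_natCast_zmod]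
  have h1 : ∀ j : ℕ, ZMod.stdAddChar ((Equiv.addRight ((h + 1 : ℕ) : ZMod p) (j : ZMod p)) ^ 2) =
      zetaC p ^ ((j + h + 1) ^ 2) := fun j => by
    rw [← stdAddChar_natCast]; push_cast; congr 2; simp [add_assoc]
  simp only [h1]
  have h2 := sum_pow_sq_eq_prod (h := h) (z := zetaC p) (by rw [← hp]; exact hz)
  rw [← hp] at h2
  rw [h2]
  simp only [zetaC_pow_sub_inv_pow]
  rw [Finset.prod_mul_distrib, Finset.prod_const, Finset.card_range]
  push_cast
  rfl

theorem neg_one_pow_mul_prod_sin_pos {p h : ℕ} (hp : p = 2 * h + 1) :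
    0 < (-1 : ℝ) ^ (h / 2) *
      ∏ j ∈ Finset.range h, (2 * Real.sin (2 * Real.pi * (2 * j + 1 : ℕ) / p)) := by
  have hp0 : (0 : ℝ) < p := by rw [hp]; positivity
  have hpi := Real.pi_pos
  have hcard : (-1 : ℝ) ^ (h / 2) = ∏ _j ∈ Finset.Ico ((h + 1) / 2) h, (-1 : ℝ) := by
    rw [Finset.prod_const, Nat.card_Ico]; congr 1; omega
  rw [← Finset.prod_range_mul_prod_Ico _ (show (h + 1) / 2 ≤ h by omega), hcard, mul_left_comm,
    ← Finset.prod_mul_distrib]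
  refine mul_pos (Finset.prod_pos fun j hj => ?_) (Finset.prod_pos fun j hj => ?_)
  · have hj' := Finset.mem_range.1 hj
    refine mul_pos two_pos (Real.sin_pos_of_pos_of_lt_pi (by positivity) ?_)
    rw [div_lt_iff₀ hp0]
    have : ((2 * (2 * j + 1) : ℕ) : ℝ) < p := by rw [Nat.cast_lt]; omega
    push_cast at this ⊢
    nlinarith
  · have hj' := Finset.mem_Ico.1 hj
    have h1 : (p : ℝ) < (2 * (2 * j + 1) : ℕ) := by rw [Nat.cast_lt]; omega
    have h2 : ((2 * j + 1 : ℕ) : ℝ) < p := by rw [Nat.cast_lt]; omega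
    have h3 : 0 < Real.sin (2 * Real.pi * (2 * j + 1 : ℕ) / p - Real.pi) := by
      refine Real.sin_pos_of_pos_of_lt_pi ?_ ?_
      · rw [sub_pos, lt_div_iff₀ hp0]
        push_cast at h1 ⊢
        nlinarith
      · rw [sub_lt_iff_lt_add, div_lt_iff₀ hp0]
        nlinarith
    rw [Real.sin_sub_pi] at h3
    linarith

theorem sum_stdAddChar_mul_sq {p : ℕ} [Fact p.Prime] (hodd : p ≠ 2) {a : ZMod p} (ha : a ≠ 0) :
    ∑ x : ZMod p, (ZMod.stdAddChar (a * x ^ 2) : ℂ) =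
      ∑ c : ZMod p, (quadraticChar (ZMod p) (a * c) : ℂ) * ZMod.stdAddChar c := by
  have hchar : ringChar (ZMod p) ≠ 2 := by rwa [ZMod.ringChar_zmod_n]
  have h1 : ∑ x : ZMod p, (ZMod.stdAddChar (a * x ^ 2) : ℂ) =
      ∑ b : ZMod p, ((quadraticChar (ZMod p) b + 1 : ℤ) : ℂ) * ZMod.stdAddChar (a * b) := by
    rw [← Finset.sum_fiberwise (s := Finset.univ) (g := fun x : ZMod p => x ^ 2)]
    refine Finset.sum_congr rfl fun b _ => ?_
    rw [Finset.sum_congr rfl (g := fun _ => (ZMod.stdAddChar (a * b) : ℂ)) fun x hx => by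
      rw [(Finset.mem_filter.1 hx).2], Finset.sum_const, nsmul_eq_mul,
      ← quadraticChar_card_sqrts hchar b]
    congr 2
    congr 1
    ext x; simp
  have h2 : ∑ b : ZMod p, (ZMod.stdAddChar (a * b) : ℂ) = 0 := by
    have := AddChar.sum_mulShift (R' := ℂ) a (ZMod.isPrimitive_stdAddChar p)
    simpa [mul_comm, ha] using this
  rw [h1]
  push_cast
  simp only [add_mul, one_mul, Finset.sum_add_distrib, h2, add_zero]
  symm
  rw [← Equiv.sum_comp (Equiv.mulLeft₀ a ha)]
  refine Finset.sum_congr rfl fun b _ => ?_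
  rw [Equiv.mulLeft₀_apply, ← mul_assoc, ← sq, map_mul, quadraticChar_sq_one' ha, one_mul]

theorem sqrtStar_sq {p : ℕ} (hodd : p % 2 = 1) : sqrtStar p ^ 2 = (-1) ^ (p / 2) * p := by
  have hs : ((Real.sqrt p : ℝ) : ℂ) ^ 2 = p := by
    rw [← Complex.ofReal_pow, Real.sq_sqrt (Nat.cast_nonneg p), Complex.ofReal_natCast]
  rw [sqrtStar]
  split_ifs with h
  · rw [hs, Even.neg_one_pow (by rw [Nat.even_iff]; omega), one_mul]
  · rw [mul_pow, hs, Complex.I_sq, Odd.neg_one_pow (by rw [Nat.odd_iff]; omega)]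

theorem quadGaussSum_sq {p : ℕ} [Fact p.Prime] (hodd : p % 2 = 1) :
    (∑ x : ZMod p, (ZMod.stdAddChar (x ^ 2) : ℂ)) ^ 2 = (-1) ^ (p / 2) * p := by
  have hp2 : p ≠ 2 := by omega
  have hchar : ringChar (ZMod p) ≠ 2 := by rwa [ZMod.ringChar_zmod_n]
  have h1 := sum_stdAddChar_mul_sq hp2 (one_ne_zero (α := ZMod p))
  simp only [one_mul] at h1
  rw [h1]
  have hne : (quadraticChar (ZMod p)).ringHomComp (Int.castRingHom ℂ) ≠ 1 := by
    intro h0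
    obtain ⟨a, ha⟩ := quadraticChar_exists_neg_one hchar
    have ha0 : a ≠ 0 := by rintro rfl; simp at ha
    have := congrArg (fun χ : MulChar (ZMod p) ℂ => χ a) h0
    rw [MulChar.ringHomComp_apply, ha, MulChar.one_apply ha0.isUnit] at this
    norm_num at this
  have h2 := gaussSum_sq hne ((quadraticChar_isQuadratic (ZMod p)).comp _)
    (ZMod.isPrimitive_stdAddChar p)
  rw [gaussSum] at h2
  simp only [MulChar.ringHomComp_apply, eq_intCast] at h2
  rw [h2, quadraticChar_neg_one hchar, ZMod.χ₄_eq_neg_one_pow (by rwa [ZMod.card]), ZMod.card]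
  push_cast
  rfl

/-- Gauss's determination of the sign of the quadratic Gauss sum. -/
theorem quadGaussSum_eq_sqrtStar {p : ℕ} [Fact p.Prime] (hodd : p % 2 = 1) :
    ∑ x : ZMod p, (ZMod.stdAddChar (x ^ 2) : ℂ) = sqrtStar p := by
  obtain ⟨h, hp⟩ : ∃ h, p = 2 * h + 1 := ⟨p / 2, by omega⟩
  have hsq := quadGaussSum_sq (p := p) hodd
  have hprod := quadGaussSum_eq_prod hp
  have hpos := neg_one_pow_mul_prod_sin_pos hp
  set P := ∏ j ∈ Finset.range h, (2 * Real.sin (2 * Real.pi * (2 * j + 1 : ℕ) / p)) with hP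
  have hPsq : P ^ 2 = p := by
    rw [hprod, mul_pow, ← pow_mul, mul_comm h, pow_mul, Complex.I_sq, show p / 2 = h by omega,
      mul_right_inj' (pow_ne_zero _ (by norm_num))] at hsq
    exact_mod_cast hsq
  have hval : (-1 : ℝ) ^ (h / 2) * P = Real.sqrt p := by
    rw [eq_comm, Real.sqrt_eq_iff_mul_self_eq_of_pos hpos, ← hPsq]
    have : ((-1 : ℝ) ^ (h / 2)) ^ 2 = 1 := by rw [← pow_mul, mul_comm, pow_mul]; simp
    linear_combination P ^ 2 * this
  rw [hprod, sqrtStar, ← hval]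
  push_cast
  split_ifs with h4
  · rw [show h = 2 * (h / 2) by omega, pow_mul, Complex.I_sq]; simp
  · conv_lhs => rw [show h = 2 * (h / 2) + 1 by omega, pow_succ, pow_mul, Complex.I_sq]
    ring

theorem sum_stdAddChar_mul_sq_eq {p : ℕ} [Fact p.Prime] (hodd : p % 2 = 1) {a : ZMod p}
    (ha : a ≠ 0) :
    ∑ x : ZMod p, (ZMod.stdAddChar (a * x ^ 2) : ℂ) =
      (quadraticChar (ZMod p) a : ℂ) * sqrtStar p := by
  have hp2 : p ≠ 2 := by omega
  have h1 := sum_stdAddChar_mul_sq hp2 (one_ne_zero (α := ZMod p))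
  simp only [one_mul] at h1
  rw [sum_stdAddChar_mul_sq hp2 ha, ← quadGaussSum_eq_sqrtStar hodd, h1, Finset.mul_sum]
  exact Finset.sum_congr rfl fun c _ => by rw [map_mul]; push_cast; ring

theorem sqrtStar_eq_sum {p : ℕ} [Fact p.Prime] (hodd : p % 2 = 1) :
    sqrtStar p = ∑ c : ZMod p, (quadraticChar (ZMod p) c : ℂ) * ZMod.stdAddChar c := by
  have h1 := sum_stdAddChar_mul_sq (p := p) (by omega) one_ne_zero
  simp only [one_mul] at h1
  rw [← quadGaussSum_eq_sqrtStar hodd, h1]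

theorem eq_of_sum_intCast_mul_stdAddChar_eq_zero {p : ℕ} [hp : Fact p.Prime] {b : ZMod p → ℤ}
    (h : ∑ c, (b c : ℂ) * ZMod.stdAddChar c = 0) (c : ZMod p) : b c = b ((p - 1 : ℕ) : ZMod p) := by
  have hp1 : p - 1 + 1 = p := Nat.sub_add_cancel hp.out.pos
  set e := b ((p - 1 : ℕ) : ZMod p) with he
  have hz := zetaC_isPrimitiveRoot p
  have hsum : ∑ c : ZMod p, (ZMod.stdAddChar c : ℂ) = 0 := by
    have := AddChar.sum_mulShift (R' := ℂ) 1 (ZMod.isPrimitive_stdAddChar p)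
    simpa using this
  have h1 : ∑ j ∈ Finset.range (p - 1), ((b (j : ZMod p) - e : ℤ) : ℂ) * zetaC p ^ j = 0 := by
    have h2 : ∑ c, ((b c - e : ℤ) : ℂ) * ZMod.stdAddChar c = 0 := by
      push_cast
      simp only [sub_mul, Finset.sum_sub_distrib, h, ← Finset.mul_sum, hsum]
      simp
    rw [← sum_range_natCast_zmod, show Finset.range p = Finset.range (p - 1 + 1) by rw [hp1],
      Finset.sum_range_succ, ← he, sub_self] at h2
    simpa [stdAddChar_natCast] using h2
  set R : Polynomial ℚ := ∑ j ∈ Finset.range (p - 1),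
    Polynomial.monomial j ((b (j : ZMod p) - e : ℤ) : ℚ) with hR
  have hR0 : R = 0 := by
    refine Polynomial.eq_zero_of_dvd_of_degree_lt (p := minpoly ℚ (zetaC p)) ?_ ?_
    · refine minpoly.dvd _ _ ?_
      rw [hR, map_sum, ← h1]
      refine Finset.sum_congr rfl fun j _ => ?_
      rw [Polynomial.aeval_monomial]
      simp
    · rw [← Polynomial.cyclotomic_eq_minpoly_rat hz hp.out.pos, Polynomial.degree_cyclotomic,
        Nat.totient_prime hp.out]
      refine lt_of_le_of_lt (Polynomial.degree_sum_le _ _) ?_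
      rw [Finset.sup_lt_iff (WithBot.bot_lt_coe _)]
      intro j hj
      refine lt_of_le_of_lt (Polynomial.degree_monomial_le _ _) ?_
      exact_mod_cast Finset.mem_range.1 hj
  rcases Nat.lt_or_ge c.val (p - 1) with hc | hc
  · have h3 := congrArg (fun r => Polynomial.coeff r c.val) hR0
    simp only [hR, Polynomial.finsetSum_coeff, Polynomial.coeff_monomial, Polynomial.coeff_zero,
      Finset.sum_ite_eq', Finset.mem_range, hc, if_true, ZMod.natCast_val, ZMod.cast_id] at h3
    have h4 : b c - e = 0 := by exact_mod_cast h3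
    omega
  · have h3 : c.val = p - 1 := by have := ZMod.val_lt c; omega
    rw [he, ← h3]; simp

/-- An exponential sum with known integral expansion determines the sizes of the level sets. -/
theorem card_level_of_sum_stdAddChar {p : ℕ} [hp : Fact p.Prime] {V : Type*} [Fintype V]
    (f : V → ZMod p) (a : ZMod p → ℤ)
    (h : ∑ x, (ZMod.stdAddChar (f x) : ℂ) = ∑ c, (a c : ℂ) * ZMod.stdAddChar c) (c : ZMod p) :
    (p : ℤ) * (Finset.univ.filter fun x => f x = c).card =
      p * a c + Fintype.card V - ∑ c, a c := by
  set N : ZMod p → ℤ := fun c => ((Finset.univ.filter fun x => f x = c).card : ℤ) with hN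
  have h1 : ∑ c, ((N c - a c : ℤ) : ℂ) * ZMod.stdAddChar c = 0 := by
    push_cast
    simp only [sub_mul, Finset.sum_sub_distrib, ← h]
    rw [sub_eq_zero, ← Finset.sum_fiberwise (s := Finset.univ) (g := f)]
    refine Finset.sum_congr rfl fun b _ => ?_
    rw [Finset.sum_congr rfl (g := fun _ => (ZMod.stdAddChar b : ℂ)) fun x hx => by
      rw [(Finset.mem_filter.1 hx).2], Finset.sum_const, nsmul_eq_mul]
    simp [hN]
  have h2 := eq_of_sum_intCast_mul_stdAddChar_eq_zero (b := fun c => N c - a c) h1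
  set e := N ((p - 1 : ℕ) : ZMod p) - a ((p - 1 : ℕ) : ZMod p)
  have h3 : ∑ c, N c = Fintype.card V := by
    have := Finset.card_eq_sum_card_fiberwise (f := f) (s := Finset.univ) (t := Finset.univ)
      (fun _ _ => Finset.mem_coe.2 (Finset.mem_univ _))
    rw [Finset.card_univ] at this
    rw [this]; push_cast; rfl
  have h4 : ∑ c : ZMod p, (N c - a c) = p * e := by
    rw [Finset.sum_congr rfl fun c _ => h2 c, Finset.sum_const, Finset.card_univ, ZMod.card,
      nsmul_eq_mul]
  rw [Finset.sum_sub_distrib, h3] at h4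
  have h5 := h2 c
  change (p : ℤ) * N c = _
  linear_combination (p : ℤ) * h5 - h4

theorem stdAddChar_sum {p : ℕ} [NeZero p] {ι : Type*} (t : Finset ι) (f : ι → ZMod p) :
    (ZMod.stdAddChar (∑ i ∈ t, f i) : ℂ) = ∏ i ∈ t, ZMod.stdAddChar (f i) := by
  induction t using Finset.induction_on with
  | empty => simp
  | insert i t hi ih =>
    rw [Finset.sum_insert hi, Finset.prod_insert hi, AddChar.map_add_eq_mul, ih]

/-- The exponential sum of a nondegenerate quadratic form over `F_p`. -/
theorem sum_stdAddChar_quadraticForm {p : ℕ} [hp : Fact p.Prime] (hodd : p % 2 = 1) {V : Type*}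
    [AddCommGroup V] [Module (ZMod p) V] [Fintype V] (Q : QuadraticForm (ZMod p) V)
    (hQ : ∀ x, (∀ y, QuadraticMap.polar Q x y = 0) → x = 0) :
    ∃ ε : ℤ, (ε = 1 ∨ ε = -1) ∧ ∀ c : ZMod p, c ≠ 0 →
      ∑ x, (ZMod.stdAddChar (c * Q x) : ℂ) =
        ε * (quadraticChar (ZMod p) c : ℂ) ^ Module.finrank (ZMod p) V *
          sqrtStar p ^ Module.finrank (ZMod p) V := by
  have h2 : (2 : ZMod p) ≠ 0 := by
    have : ((2 : ℕ) : ZMod p) ≠ 0 := by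
      rw [Ne, ZMod.natCast_eq_zero_iff, Nat.prime_dvd_prime_iff_eq hp.out Nat.prime_two]
      omega
    exact_mod_cast this
  let _ : Invertible (2 : ZMod p) := invertibleOfNonzero h2
  have hsep : LinearMap.SeparatingLeft (QuadraticMap.associated (R := ZMod p) Q) := by
    intro x hx
    refine hQ x fun y => ?_
    have := hx y
    rw [← QuadraticMap.polarBilin_apply_apply, ← QuadraticMap.two_nsmul_associated (ZMod p)]
    simp only [LinearMap.smul_apply, this, smul_zero]
  obtain ⟨w, ⟨e⟩⟩ := QuadraticForm.equivalent_weightedSumSquares_units_of_nondegenerate' Q hsep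
  refine ⟨∏ i, quadraticChar (ZMod p) (w i), ?_, fun c hc => ?_⟩
  · refine Finset.prod_induction _ (fun ε : ℤ => ε = 1 ∨ ε = -1) ?_ (Or.inl rfl) fun i _ =>
      quadraticChar_dichotomy (w i).ne_zero
    rintro a b (rfl | rfl) (rfl | rfl) <;> simp
  · have h3 : ∀ x, Q x = ∑ i, (w i : ZMod p) * (e x i) ^ 2 := fun x => by
      rw [← e.map_app x, QuadraticMap.weightedSumSquares_apply]
      refine Finset.sum_congr rfl fun i _ => ?_
      rw [sq]; rfl
    have hcomp : ∑ x, (ZMod.stdAddChar (c * Q x) : ℂ) =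
        ∑ y : Fin (Module.finrank (ZMod p) V) → ZMod p,
          (ZMod.stdAddChar (c * ∑ i, (w i : ZMod p) * (y i) ^ 2) : ℂ) :=
      Fintype.sum_equiv e.toLinearEquiv.toEquiv _ _ fun x => by rw [h3]; rfl
    rw [hcomp]
    have h4 : ∀ y : Fin (Module.finrank (ZMod p) V) → ZMod p,
        (ZMod.stdAddChar (c * ∑ i, (w i : ZMod p) * (y i) ^ 2) : ℂ) =
        ∏ i, ZMod.stdAddChar (c * (w i : ZMod p) * (y i) ^ 2) := fun y => by
      rw [Finset.mul_sum, stdAddChar_sum]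
      exact Finset.prod_congr rfl fun i _ => by rw [mul_assoc]
    simp only [h4]
    rw [← Fintype.prod_sum (fun i (z : ZMod p) =>
      (ZMod.stdAddChar (c * (w i : ZMod p) * z ^ 2) : ℂ))]
    simp only [fun i => sum_stdAddChar_mul_sq_eq hodd (mul_ne_zero hc (w i).ne_zero), map_mul]
    push_cast
    rw [Finset.prod_mul_distrib, Finset.prod_mul_distrib]
    simp only [Finset.prod_const, Finset.card_univ, Fintype.card_fin]
    ring

section TraceChar

variable (p : ℕ) [hp : Fact p.Prime] (F : Type*) [Field F] [Algebra (ZMod p) F]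

/-- The canonical additive character of a finite field of characteristic `p`. -/
def traceChar : AddChar F ℂ :=
  (ZMod.stdAddChar (N := p)).compAddMonoidHom (Algebra.trace (ZMod p) F).toAddMonoidHom

variable {F}

theorem traceChar_apply (x : F) :
    traceChar p F x = ZMod.stdAddChar (Algebra.trace (ZMod p) F x) := rfl

theorem traceChar_congr {x y : F} (h : Algebra.trace (ZMod p) F x = Algebra.trace (ZMod p) F y) :
    traceChar p F x = traceChar p F y := by
  rw [traceChar_apply, traceChar_apply, h]

theorem traceChar_eq_one_iff (x : F) :
    traceChar p F x = 1 ↔ Algebra.trace (ZMod p) F x = 0 := by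
  rw [traceChar_apply, ← AddChar.map_zero_eq_one (ZMod.stdAddChar (N := p))]
  exact ZMod.injective_stdAddChar.eq_iff

theorem conj_traceChar [Finite F] (x : F) :
    (starRingEnd ℂ) (traceChar p F x) = traceChar p F (-x) := by
  rw [AddChar.map_neg_eq_conj]

theorem forall_trace_mul_eq_zero_iff [Finite F] {a : F} :
    (∀ x, Algebra.trace (ZMod p) F (a * x) = 0) ↔ a = 0 :=
  ⟨fun h => (traceForm_nondegenerate (ZMod p) F).1 a h, fun h x => by rw [h, zero_mul, map_zero]⟩

theorem sum_traceChar_mul [Fintype F] (a : F) :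
    ∑ x, traceChar p F (a * x) = if a = 0 then (Fintype.card F : ℂ) else 0 := by
  simp_rw [mul_comm a]
  rw [AddChar.sum_mulShift, Nat.cast_ite, Nat.cast_zero]
  refine fun b hb h => hb ((forall_trace_mul_eq_zero_iff p).1 fun x => ?_)
  rw [← traceChar_eq_one_iff, ← AddChar.mulShift_apply, h, AddChar.one_apply]

end TraceChar

section TwistedForm

theorem two_ne_zero_of_odd (p : ℕ) [hp : Fact p.Prime] (F : Type*) [Field F] [Algebra (ZMod p) F]
    (hodd : p % 2 = 1) : (2 : F) ≠ 0 := by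
  have : CharP F p := charP_of_injective_algebraMap (algebraMap (ZMod p) F).injective p
  have h : ((2 : ℕ) : F) ≠ 0 := by
    rw [Ne, CharP.cast_eq_zero_iff F p, Nat.prime_dvd_prime_iff_eq hp.out Nat.prime_two]
    omega
  exact_mod_cast h

theorem zmod_two_ne_zero (p : ℕ) {F : Type*} [Field F] [Algebra (ZMod p) F] (h2 : (2 : F) ≠ 0) :
    (2 : ZMod p) ≠ 0 := fun h =>
  h2 (by rw [← map_ofNat (algebraMap (ZMod p) F) 2, h, map_zero])

variable {p : ℕ} [hp : Fact p.Prime] {F : Type*} [Field F] [Algebra (ZMod p) F]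
  (s σ : F ≃ₐ[ZMod p] F)

/-- The quadratic map `x ↦ α x s(x) / 2 + β x σ(x)`. -/
def twistedForm (α β x : F) : F := α * (x * s x) / 2 + β * (x * σ x)

/-- The polar map of `twistedForm` with respect to the trace pairing. -/
def twistedPolar (α β : F) : F →ₗ[ZMod p] F :=
  LinearMap.mulLeft (ZMod p) α ∘ₗ s.toLinearMap + LinearMap.mulLeft (ZMod p) β ∘ₗ σ.toLinearMap +
    σ.symm.toLinearMap ∘ₗ LinearMap.mulLeft (ZMod p) β

theorem twistedPolar_apply (α β x : F) :
    twistedPolar s σ α β x = α * s x + β * σ x + σ.symm (β * x) := rfl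

/-- The Weil sum of `twistedForm` with a linear twist. -/
def weilSum [Fintype F] (α β γ : F) : ℂ :=
  ∑ x, traceChar p F (twistedForm s σ α β x + γ * x)

theorem trace_mul_apply_comm (τ : F ≃ₐ[ZMod p] F) (b x y : F) :
    Algebra.trace (ZMod p) F (b * x * τ y) = Algebra.trace (ZMod p) F (τ.symm (b * x) * y) := by
  rw [← Algebra.trace_eq_of_algEquiv τ (τ.symm (b * x) * y), map_mul τ, AlgEquiv.apply_symm_apply]

variable {s σ}

theorem trace_half_apply_comm (hs : ∀ x, s (s x) = x) {α : F} (hα : s α = α)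
    (x y : F) : Algebra.trace (ZMod p) F (α * (x * s y) / 2) =
      Algebra.trace (ZMod p) F (α * (y * s x) / 2) := by
  rw [← Algebra.trace_eq_of_algEquiv s]
  simp only [map_div₀, map_mul, hα, hs, map_ofNat, mul_comm]

theorem trace_twistedForm_add (h2 : (2 : F) ≠ 0) (hs : ∀ x, s (s x) = x) {α : F} (hα : s α = α)
    (β x y : F) :
    Algebra.trace (ZMod p) F (twistedForm s σ α β (x + y)) =
      Algebra.trace (ZMod p) F (twistedForm s σ α β x) +
      Algebra.trace (ZMod p) F (twistedForm s σ α β y) +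
      Algebra.trace (ZMod p) F (twistedPolar s σ α β y * x) := by
  have h1 : twistedForm s σ α β (x + y) = twistedForm s σ α β x + twistedForm s σ α β y +
      (α * (x * s y) / 2 + α * (y * s x) / 2 + β * x * σ y + β * y * σ x) := by
    simp only [twistedForm, map_add]; ring
  have h3 : twistedPolar s σ α β y * x =
      α * (x * s y) / 2 + α * (x * s y) / 2 + β * x * σ y + σ.symm (β * y) * x := by
    rw [twistedPolar_apply, ← add_div, ← two_mul, mul_div_cancel_left₀ _ h2]
    ring
  rw [h1, h3]
  simp only [map_add, trace_mul_apply_comm, trace_half_apply_comm hs hα y x]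

theorem trace_twistedPolar_mul_comm (h2 : (2 : F) ≠ 0) (hs : ∀ x, s (s x) = x) {α : F}
    (hα : s α = α) (β x y : F) :
    Algebra.trace (ZMod p) F (twistedPolar s σ α β y * x) =
      Algebra.trace (ZMod p) F (twistedPolar s σ α β x * y) := by
  have h1 := trace_twistedForm_add (σ := σ) h2 hs hα β x y
  have h3 := trace_twistedForm_add (σ := σ) h2 hs hα β y x
  rw [add_comm y x] at h3
  linear_combination h3 - h1

theorem trace_twistedPolar_mul_self (h2 : (2 : F) ≠ 0) (hs : ∀ x, s (s x) = x) {α : F}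
    (hα : s α = α) (β x : F) :
    Algebra.trace (ZMod p) F (twistedPolar s σ α β x * x) =
      2 * Algebra.trace (ZMod p) F (twistedForm s σ α β x) := by
  have h1 := trace_twistedForm_add (σ := σ) h2 hs hα β x (-x)
  have h3 : twistedForm s σ α β (-x) = twistedForm s σ α β x := by
    simp only [twistedForm, map_neg]; ring
  have h4 : twistedForm s σ α β 0 = 0 := by simp [twistedForm]
  rw [add_neg_cancel, h3, h4, map_zero, map_neg, neg_mul, map_neg] at h1
  linear_combination h1

variable [Fintype F]

/-- The values of `weilSum` on the range of the polar map. -/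
theorem weilSum_twistedPolar (h2 : (2 : F) ≠ 0) (hs : ∀ x, s (s x) = x) {α : F} (hα : s α = α)
    (β y : F) : weilSum s σ α β (twistedPolar s σ α β y) =
      traceChar p F (-twistedForm s σ α β y) * weilSum s σ α β 0 := by
  have h1 : weilSum s σ α β 0 = ∑ x, traceChar p F (twistedForm s σ α β (x + y)) := by
    simp only [weilSum, zero_mul, add_zero]
    exact (Equiv.sum_comp (Equiv.addRight y) fun x => traceChar p F (twistedForm s σ α β x)).symm
  rw [h1, weilSum, Finset.mul_sum]
  refine Finset.sum_congr rfl fun x _ => ?_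
  rw [← AddChar.map_add_eq_mul]
  refine traceChar_congr p ?_
  simp only [map_add, map_neg, trace_twistedForm_add h2 hs hα]
  ring

/-- `weilSum` vanishes off the range of the polar map. -/
theorem exists_twistedPolar_eq_of_weilSum_ne_zero (h2 : (2 : F) ≠ 0)
    (hs : ∀ x, s (s x) = x) {α : F} (hα : s α = α) (β : F) {γ : F} (h : weilSum s σ α β γ ≠ 0) :
    ∃ y, twistedPolar s σ α β y = γ := by
  set φ := twistedPolar s σ α β with hφ
  have h1 : ∀ y, φ y = 0 → Algebra.trace (ZMod p) F (γ * y) = 0 := by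
    intro y hy
    have h3 : Algebra.trace (ZMod p) F (twistedForm s σ α β y) = 0 := by
      have := trace_twistedPolar_mul_self (σ := σ) h2 hs hα β y
      rw [← hφ, hy, zero_mul, map_zero] at this
      exact (mul_eq_zero.1 this.symm).resolve_left (zmod_two_ne_zero p h2)
    have h4 : weilSum s σ α β γ = traceChar p F (γ * y) * weilSum s σ α β γ := by
      conv_lhs =>
        rw [weilSum, ← Equiv.sum_comp (Equiv.addRight y)]
      rw [weilSum, Finset.mul_sum]
      refine Finset.sum_congr rfl fun x _ => ?_
      rw [← AddChar.map_add_eq_mul]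
      refine traceChar_congr p ?_
      rw [Equiv.coe_addRight, mul_add]
      simp only [map_add, trace_twistedForm_add h2 hs hα, h3, ← hφ, hy, zero_mul, map_zero]
      ring
    rw [← traceChar_eq_one_iff]
    exact (mul_eq_right₀ h).1 h4.symm
  set B := Algebra.traceForm (ZMod p) F with hB
  have hBn : B.Nondegenerate := traceForm_nondegenerate (ZMod p) F
  have hBr : B.IsRefl := (Algebra.traceForm_isSymm (ZMod p)).isRefl
  have h5 : B.orthogonal (LinearMap.range φ) ≤ LinearMap.ker φ := by
    intro x hx
    rw [LinearMap.mem_ker, ← forall_trace_mul_eq_zero_iff p]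
    intro y
    have := hx (φ y) ⟨y, rfl⟩
    rw [hφ, trace_twistedPolar_mul_comm h2 hs hα]
    exact this
  have h6 : γ ∈ B.orthogonal (B.orthogonal (LinearMap.range φ)) := by
    intro y hy
    have := h1 y (h5 hy)
    rw [mul_comm] at this
    exact this
  rw [LinearMap.BilinForm.orthogonal_orthogonal hBn hBr] at h6
  exact h6

theorem weilSum_mul_conj (h2 : (2 : F) ≠ 0)
    (hs : ∀ x, s (s x) = x) {α : F} (hα : s α = α) (β : F) :
    weilSum s σ α β 0 * (starRingEnd ℂ) (weilSum s σ α β 0) =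
      Fintype.card F * (Finset.univ.filter fun x => twistedPolar s σ α β x = 0).card := by
  have h1 : ∀ z, ∑ y, traceChar p F (twistedForm s σ α β (z + y)) *
      traceChar p F (-twistedForm s σ α β y) =
      if twistedPolar s σ α β z = 0 then (Fintype.card F : ℂ) else 0 := by
    intro z
    have h3 : ∀ y, traceChar p F (twistedForm s σ α β (z + y)) *
        traceChar p F (-twistedForm s σ α β y) = traceChar p F (twistedForm s σ α β z) *
          traceChar p F (twistedPolar s σ α β z * y) := fun y => by
      rw [← AddChar.map_add_eq_mul, ← AddChar.map_add_eq_mul]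
      refine traceChar_congr p ?_
      simp only [map_add, map_neg, trace_twistedForm_add h2 hs hα,
        trace_twistedPolar_mul_comm h2 hs hα β z y]
      ring
    simp only [h3]
    rw [← Finset.mul_sum, sum_traceChar_mul]
    split_ifs with hz
    · have h4 := trace_twistedPolar_mul_self (σ := σ) h2 hs hα β z
      rw [hz, zero_mul, map_zero] at h4
      rw [(traceChar_eq_one_iff p _).2 ((mul_eq_zero.1 h4.symm).resolve_left (zmod_two_ne_zero p h2)),
        one_mul]
    · rw [mul_zero]
  simp only [weilSum, zero_mul, add_zero, map_sum, conj_traceChar]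
  rw [Finset.sum_mul_sum, Finset.sum_comm]
  rw [Finset.sum_congr rfl fun y _ => (Equiv.sum_comp (Equiv.addRight y) _).symm, Finset.sum_comm]
  simp only [Equiv.coe_addRight, h1]
  rw [← Finset.sum_filter, Finset.sum_const, nsmul_eq_mul, mul_comm]

end TwistedForm

section Evaluation

variable {p : ℕ} [hp : Fact p.Prime] {F : Type*} [Field F] [Algebra (ZMod p) F]
  (s σ : F ≃ₐ[ZMod p] F)

/-- The trace of `twistedForm` as a quadratic form over the prime field. -/
def traceQuadraticForm (h2 : (2 : F) ≠ 0) (hs : ∀ x, s (s x) = x) {α : F} (hα : s α = α) (β : F) :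
    QuadraticForm (ZMod p) F :=
  QuadraticMap.ofPolar (fun x => Algebra.trace (ZMod p) F (twistedForm s σ α β x))
    (fun a x => by
      rw [smul_eq_mul, ← smul_eq_mul, ← map_smul]
      congr 1
      simp only [twistedForm, Algebra.smul_def, map_mul, AlgEquiv.commutes]
      ring)
    (fun x y z => by
      simp only [QuadraticMap.polar, trace_twistedForm_add h2 hs hα, mul_add, map_add]
      ring)
    (fun a x y => by
      simp only [QuadraticMap.polar, trace_twistedForm_add h2 hs hα, mul_smul_comm, map_smul,
        smul_eq_mul]
      ring)

variable {s σ}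

/-- An exponential sum of a nondegenerate form in even dimension is rational. -/
theorem weilSum_eq_or_eq_neg [Fintype F] (hodd : p % 2 = 1) {m : ℕ}
    (hF : Fintype.card F = p ^ (2 * m)) (hs : ∀ x, s (s x) = x) {α : F} (hα : s α = α) (β : F)
    (hker : ∀ x, twistedPolar s σ α β x = 0 → x = 0) :
    weilSum s σ α β 0 = (p : ℂ) ^ m ∨ weilSum s σ α β 0 = -(p : ℂ) ^ m := by
  have h2 : (2 : F) ≠ 0 := two_ne_zero_of_odd p F hodd
  obtain ⟨ε, hε, h⟩ := sum_stdAddChar_quadraticForm hodd (traceQuadraticForm s σ h2 hs hα β)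
    (fun x hx => hker x ((forall_trace_mul_eq_zero_iff p).1 fun y => by
      have := hx y
      simp only [traceQuadraticForm, QuadraticMap.polar, QuadraticMap.ofPolar_apply,
        trace_twistedForm_add h2 hs hα] at this
      rw [trace_twistedPolar_mul_comm h2 hs hα]
      linear_combination this))
  have hrank : Module.finrank (ZMod p) F = 2 * m := by
    have h3 := Module.card_eq_pow_finrank (K := ZMod p) (V := F)
    rw [hF, ZMod.card] at h3
    exact (Nat.pow_right_injective hp.out.two_le h3).symm
  have h4 := h 1 one_ne_zero
  rw [map_one, Int.cast_one, one_pow, mul_one, hrank, pow_mul, sqrtStar_sq hodd, mul_pow,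
    ← pow_mul] at h4
  have h5 : weilSum s σ α β 0 = ε * ((-1 : ℂ) ^ (p / 2 * m) * (p : ℂ) ^ m) := by
    rw [← h4]
    refine Finset.sum_congr rfl fun x _ => ?_
    rw [zero_mul, add_zero, one_mul]; rfl
  rw [h5]
  rcases neg_one_pow_eq_or ℂ (p / 2 * m) with h6 | h6 <;> rcases hε with rfl | rfl <;>
    simp [h6]

/-- Pulling back the sum to a degenerate vector. -/
theorem weilSum_scale [Fintype F] (α β : F) {x₀ : F} (hx : x₀ ≠ 0) :
    weilSum s σ (α * (x₀ * s x₀)) (β * (x₀ * σ x₀)) 0 = weilSum s σ α β 0 := by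
  rw [weilSum, weilSum, ← Equiv.sum_comp (Equiv.mulLeft₀ x₀ hx)
    fun x => traceChar p F (twistedForm s σ α β x + 0 * x)]
  refine Finset.sum_congr rfl fun x _ => ?_
  rw [show Equiv.mulLeft₀ x₀ hx x = x₀ * x from rfl]
  simp only [twistedForm, map_mul]
  congr 1
  ring

/-- The coefficient forced by a degenerate vector is fixed by the involution. -/
theorem apply_eq_self_of_twistedPolar_eq_zero (hs : ∀ x, s (s x) = x)
    (hc : ∀ x, s (σ x) = σ (s x)) (hanti : ∀ v, s v = -v → σ v = -v → v = 0) {α : F}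
    (hα : s α = α) {β x : F} (hx : twistedPolar s σ α β x = 0) :
    s (β * (x * σ x)) = β * (x * σ x) ∧
      α * (x * s x) = -(β * (x * σ x) + σ.symm (β * (x * σ x))) := by
  set b := β * (x * σ x) with hb
  have h1 : α * (x * s x) + (b + σ.symm b) = 0 := by
    have h3 : σ.symm b = σ.symm (β * x) * x := by
      rw [hb, ← mul_assoc, map_mul, AlgEquiv.symm_apply_apply]
    rw [h3, hb]
    rw [twistedPolar_apply] at hx
    linear_combination x * hx
  have h4 : s (b + σ.symm b) = b + σ.symm b := by
    have h5 : b + σ.symm b = -(α * (x * s x)) := by linear_combination h1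
    rw [h5, map_neg, map_mul, map_mul, hα, hs, mul_comm (s x)]
  have hc' : s (σ.symm b) = σ.symm (s b) := by
    apply σ.injective
    rw [← hc, AlgEquiv.apply_symm_apply, AlgEquiv.apply_symm_apply]
  refine ⟨?_, by linear_combination h1⟩
  rw [← sub_eq_zero]
  refine hanti _ ?_ ?_
  · rw [map_sub, hs]; ring
  · rw [map_add, hc'] at h4
    apply σ.symm.injective
    rw [AlgEquiv.symm_apply_apply, map_neg, map_sub]
    linear_combination h4

/-- Summation of a function over the image of `σ - s`. -/
theorem sum_comp_sub [Fintype F] (hs : ∀ x, s (s x) = x) (hc : ∀ x, s (σ x) = σ (s x))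
    (f : F → ℂ) : ∑ x, f (σ x - s x) =
      ∑ t ∈ Finset.univ.filter (fun t => σ t = s t), ∑ z, f z * traceChar p F (t * z) := by
  have hq : (Fintype.card F : ℂ) ≠ 0 := by exact_mod_cast Fintype.card_ne_zero
  have h1 : ∀ x, f (σ x - s x) * Fintype.card F =
      ∑ z, ∑ c, f z * traceChar p F (c * z) * traceChar p F (-(c * (σ x - s x))) := by
    intro x
    have h3 : ∀ z, ∑ c, f z * traceChar p F (c * z) * traceChar p F (-(c * (σ x - s x))) =
        if z - (σ x - s x) = 0 then f z * (Fintype.card F : ℂ) else 0 := fun z => by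
      rw [← mul_ite_zero, ← sum_traceChar_mul p, Finset.mul_sum]
      refine Finset.sum_congr rfl fun c _ => ?_
      rw [mul_assoc, ← AddChar.map_add_eq_mul]
      congr 2; ring
    simp only [h3, sub_eq_zero, Finset.sum_ite_eq', Finset.mem_univ, if_true]
  have h4 : ∀ c, ∑ x, traceChar p F (-(c * (σ x - s x))) =
      if σ c = s c then (Fintype.card F : ℂ) else 0 := by
    intro c
    have h5 : ∀ x, traceChar p F (-(c * (σ x - s x))) =
        traceChar p F ((s c - σ.symm c) * x) := fun x => by
      refine traceChar_congr p ?_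
      have h6 := trace_mul_apply_comm σ 1 c x
      have h7 := trace_mul_apply_comm s 1 c x
      have h8 : s.symm c = s c := by
        apply s.injective; rw [AlgEquiv.apply_symm_apply, hs]
      rw [one_mul] at h6 h7
      rw [h8] at h7
      simp only [mul_sub, sub_mul, map_neg, map_sub, h6, h7]
      ring
    have h9 : s c - σ.symm c = 0 ↔ σ c = s c := by
      rw [sub_eq_zero, AlgEquiv.eq_symm_apply, ← hc]
      constructor
      · intro h; rw [← hs (σ c), h]
      · intro h; rw [h, hs]
    simp only [h5, sum_traceChar_mul, h9]
  refine mul_right_cancel₀ hq ?_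
  rw [Finset.sum_mul, Finset.sum_congr rfl fun x _ => h1 x, Finset.sum_comm]
  rw [Finset.sum_congr rfl fun z _ => Finset.sum_comm, Finset.sum_comm, Finset.sum_mul,
    Finset.sum_filter]
  refine Finset.sum_congr rfl fun c _ => ?_
  simp only [← Finset.mul_sum, h4]
  split_ifs
  · rw [Finset.sum_mul]
  · simp

/-- Orthogonality of the characters of the fixed field of an involution. -/
theorem sum_fixed_traceChar_mul [Fintype F] (h2 : (2 : F) ≠ 0) (hs : ∀ x, s (s x) = x) {e : F}
    (he : s e = e) (he0 : e ≠ 0) :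
    ∑ c ∈ Finset.univ.filter (fun x => s x = x), traceChar p F (c * e) = 0 := by
  obtain ⟨w, hw⟩ := not_forall.1 fun h => mul_ne_zero h2 he0
    ((forall_trace_mul_eq_zero_iff p).1 h)
  have h3 : traceChar p F ((w + s w) * e) ≠ 1 := by
    rw [Ne, traceChar_eq_one_iff, add_mul, map_add]
    have h4 : Algebra.trace (ZMod p) F (s w * e) = Algebra.trace (ZMod p) F (w * e) := by
      rw [← Algebra.trace_eq_of_algEquiv s (w * e), map_mul s, he]
    rw [h4, ← map_add]
    convert hw using 2
    ring_nf
  have h4 : ∑ c ∈ Finset.univ.filter (fun x => s x = x), traceChar p F (c * e) =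
      traceChar p F ((w + s w) * e) *
        ∑ c ∈ Finset.univ.filter (fun x => s x = x), traceChar p F (c * e) := by
    rw [Finset.sum_filter, Finset.mul_sum]
    conv_lhs => rw [← Equiv.sum_comp (Equiv.addRight (w + s w))]
    refine Finset.sum_congr rfl fun c _ => ?_
    have h5 : s (c + (w + s w)) = c + (w + s w) ↔ s c = c := by
      rw [map_add, map_add, hs, add_comm (s w), add_left_inj]
    simp only [Equiv.coe_addRight, h5, mul_ite_zero, ← AddChar.map_add_eq_mul, ← add_mul,
      add_comm (w + s w) c]
  by_contra h5
  exact h3 ((mul_eq_right₀ h5).1 h4.symm)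

/-- The norm-form exponential sum attached to an involution. -/
theorem weilSum_norm [Fintype F] (hodd : p % 2 = 1) {m : ℕ} (hF : Fintype.card F = p ^ (2 * m))
    (hs : ∀ x, s (s x) = x) (hE : (Finset.univ.filter fun x => s x = x).card = p ^ m)
    {c : F} (hc : s c = c) (hc0 : c ≠ 0) :
    ∑ z, traceChar p F (c * (z * s z)) = -(p : ℂ) ^ m := by
  have h2 : (2 : F) ≠ 0 := two_ne_zero_of_odd p F hodd
  have hpm : (p : ℂ) ^ m ≠ 0 := pow_ne_zero _ (by exact_mod_cast hp.out.ne_zero)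
  set E := Finset.univ.filter fun x => s x = x with hEdef
  set W : F → ℂ := fun c => ∑ z, traceChar p F (c * (z * s z)) with hW
  have hval : ∀ c ∈ E.erase 0, W c = (p : ℂ) ^ m ∨ W c = -(p : ℂ) ^ m := by
    intro c hc
    have hc' := (Finset.mem_filter.1 (Finset.mem_of_mem_erase hc)).2
    have h3 : W c = weilSum s 1 (2 * c) 0 0 := by
      refine Finset.sum_congr rfl fun z _ => ?_
      rw [twistedForm]
      congr 1
      field_simp
      ring
    rw [h3]
    refine weilSum_eq_or_eq_neg hodd hF hs (by rw [map_mul, hc', map_ofNat]) 0 fun x hx => ?_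
    rw [twistedPolar_apply] at hx
    simpa [h2, Finset.ne_of_mem_erase hc] using hx
  have hsum : ∑ c ∈ E, W c = (p : ℂ) ^ m := by
    rw [hW, Finset.sum_comm, Finset.sum_eq_single 0]
    · simp [hE]
    · intro z _ hz
      exact sum_fixed_traceChar_mul h2 hs (by rw [map_mul, hs, mul_comm]) (by simpa using hz)
    · simp
  have h0 : (0 : F) ∈ E := by simp [hEdef]
  have hW0 : W 0 = (p : ℂ) ^ (2 * m) := by simp [hW, hF]
  rw [← Finset.add_sum_erase _ _ h0, hW0] at hsum
  have hzero : ∑ c ∈ E.erase 0, (W c / (p : ℂ) ^ m + 1) = 0 := by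
    rw [Finset.sum_add_distrib, ← Finset.sum_div, Finset.sum_const, Finset.card_erase_of_mem h0, hE,
      nsmul_eq_mul, Nat.cast_sub (Nat.one_le_pow _ _ hp.out.pos)]
    rw [eq_sub_of_add_eq' hsum]
    field_simp
    push_cast
    ring
  have hre : ∀ c ∈ E.erase 0, (W c / (p : ℂ) ^ m + 1).re = 0 := by
    refine (Finset.sum_eq_zero_iff_of_nonneg fun c hc => ?_).1 ?_
    · rcases hval c hc with h | h <;> rw [h]
      · rw [div_self hpm]; norm_num
      · rw [neg_div, div_self hpm]; norm_num
    · rw [← Complex.re_sum, hzero, Complex.zero_re]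
  have hcE : c ∈ E.erase 0 := Finset.mem_erase.2 ⟨hc0, Finset.mem_filter.2 ⟨Finset.mem_univ _, hc⟩⟩
  rcases hval c hcE with h | h
  · have := hre c hcE
    rw [h, div_self hpm] at this
    norm_num at this
  · exact h

/-- The degenerate sums in terms of a quadratic Gauss sum over the common fixed field. -/
theorem weilSum_degenerate [Fintype F] (hodd : p % 2 = 1) {m : ℕ}
    (hF : Fintype.card F = p ^ (2 * m)) (hs : ∀ x, s (s x) = x) (hc : ∀ x, s (σ x) = σ (s x))
    (hanti : ∀ v, s v = -v → σ v = -v → v = 0)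
    (hE : (Finset.univ.filter fun x => s x = x).card = p ^ m) {b : F} (hb : s b = b)
    (hb0 : b ≠ 0) :
    weilSum s σ (-(b + σ.symm b)) b 0 = -(p : ℂ) ^ m *
      ∑ t ∈ Finset.univ.filter (fun t => σ t = s t), traceChar p F (t ^ 2 / (2 * b)) := by
  have h2 : (2 : F) ≠ 0 := two_ne_zero_of_odd p F hodd
  have h1 : weilSum s σ (-(b + σ.symm b)) b 0 =
      ∑ x, traceChar p F (-(b / 2) * ((σ x - s x) * s (σ x - s x))) := by
    refine Finset.sum_congr rfl fun x _ => traceChar_congr p ?_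
    rw [zero_mul, add_zero, twistedForm]
    have h3 : Algebra.trace (ZMod p) F (σ.symm b * (x * s x) / 2) =
        Algebra.trace (ZMod p) F (b * (σ x * s (σ x)) / 2) := by
      rw [← Algebra.trace_eq_of_algEquiv σ]
      simp only [map_div₀, map_mul, map_ofNat, AlgEquiv.apply_symm_apply, hc]
    have h4 : Algebra.trace (ZMod p) F (b * (s x * s (σ x)) / 2) =
        Algebra.trace (ZMod p) F (b * (x * σ x) / 2) := by
      rw [← Algebra.trace_eq_of_algEquiv s (b * (x * σ x) / 2)]
      simp only [map_div₀, map_mul, map_ofNat, hb]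
    have h5 : -(b + σ.symm b) * (x * s x) / 2 + b * (x * σ x) =
        -(b * (x * s x) / 2) - σ.symm b * (x * s x) / 2 + b * (x * σ x) / 2 +
          b * (x * σ x) / 2 := by
      field_simp; ring
    have h6 : -(b / 2) * ((σ x - s x) * s (σ x - s x)) =
        -(b * (x * s x) / 2) - b * (σ x * s (σ x)) / 2 + b * (x * σ x) / 2 +
          b * (s x * s (σ x)) / 2 := by
      rw [map_sub, hs]; ring
    rw [h5, h6]
    simp only [map_add, map_sub, h3, h4]
  rw [h1, sum_comp_sub hs hc fun z => traceChar p F (-(b / 2) * (z * s z)), Finset.mul_sum]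
  refine Finset.sum_congr rfl fun t ht => ?_
  have hσt := (Finset.mem_filter.1 ht).2
  have hst : s t = t := by
    rw [← sub_eq_zero]
    refine hanti _ ?_ ?_
    · rw [map_sub, hs]; ring
    · rw [map_sub, ← hc, hσt, hs]; ring
  rw [← weilSum_norm hodd hF hs hE (c := -(b / 2)) (by rw [map_neg, map_div₀, hb, map_ofNat])
    (by simp [h2, hb0]), Finset.sum_mul, ← Equiv.sum_comp (Equiv.addRight (t / b))]
  refine Finset.sum_congr rfl fun z _ => ?_
  rw [← AddChar.map_add_eq_mul, ← AddChar.map_add_eq_mul]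
  refine traceChar_congr p ?_
  have h3 : Algebra.trace (ZMod p) F (t * s z / 2) = Algebra.trace (ZMod p) F (t * z / 2) := by
    rw [← Algebra.trace_eq_of_algEquiv s (t * z / 2)]
    simp only [map_div₀, map_mul, map_ofNat, hst]
  have h4 : -(b / 2) * ((z + t / b) * s (z + t / b)) + t * (z + t / b) =
      -(b / 2) * (z * s z) + t ^ 2 / (2 * b) + t * z / 2 - t * s z / 2 := by
    simp only [map_add, map_div₀, hst, hb]
    field_simp
    ring
  rw [Equiv.coe_addRight, h4, map_sub, map_add, h3]
  ring

end Evaluation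

section GaussSum

theorem sqrtStar_pow_odd {p d : ℕ} (hodd : p % 2 = 1) (hd : d % 2 = 1) :
    ∃ ε : ℤ, (ε = 1 ∨ ε = -1) ∧ sqrtStar p ^ d = ε * ((p : ℂ) ^ ((d - 1) / 2) * sqrtStar p) := by
  refine ⟨(-1) ^ (p / 2 * ((d - 1) / 2)), neg_one_pow_eq_or ℤ _, ?_⟩
  have h1 : d = 2 * ((d - 1) / 2) + 1 := by omega
  conv_lhs => rw [h1, pow_succ, pow_mul, sqrtStar_sq hodd, mul_pow, ← pow_mul]
  push_cast
  ring

theorem sqrtStar_ne_zero {p : ℕ} [hp : Fact p.Prime] (hodd : p % 2 = 1) : sqrtStar p ≠ 0 := by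
  intro h
  have := sqrtStar_sq (p := p) hodd
  rw [h] at this
  have h3 : (p : ℂ) ≠ 0 := by exact_mod_cast hp.out.ne_zero
  simp [h3] at this

variable {p : ℕ} [hp : Fact p.Prime] {F : Type*} [Field F] [Algebra (ZMod p) F]

/-- The equalizer of two automorphisms. -/
def eqSubmodule (s σ : F ≃ₐ[ZMod p] F) : Submodule (ZMod p) F :=
  LinearMap.eqLocus σ.toLinearMap s.toLinearMap

theorem mem_eqSubmodule {s σ : F ≃ₐ[ZMod p] F} {x : F} : x ∈ eqSubmodule s σ ↔ σ x = s x :=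
  Iff.rfl

/-- The quadratic form `t ↦ Tr (t² / (2 b))` on the common fixed field. -/
def commonForm (s σ : F ≃ₐ[ZMod p] F) (b : F) : QuadraticForm (ZMod p) (eqSubmodule s σ) :=
  QuadraticMap.ofPolar (fun t => Algebra.trace (ZMod p) F ((t : F) ^ 2 / (2 * b)))
    (fun a x => by
      rw [smul_eq_mul, ← smul_eq_mul (a * a), ← map_smul, Submodule.coe_smul]
      congr 1
      simp only [Algebra.smul_def, map_mul]
      ring)
    (fun x y z => by
      simp only [QuadraticMap.polar, ← map_sub, ← map_add, Submodule.coe_add]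
      congr 1; ring)
    (fun a x y => by
      simp only [QuadraticMap.polar, ← map_sub, ← map_smul, Submodule.coe_add, Submodule.coe_smul]
      congr 1
      simp only [Algebra.smul_def]
      ring)

variable {s σ : F ≃ₐ[ZMod p] F}

theorem polar_commonForm (h2 : (2 : F) ≠ 0) (b : F) (x y : eqSubmodule s σ) :
    QuadraticMap.polar (commonForm s σ b) x y =
      Algebra.trace (ZMod p) F ((x : F) * y / b) := by
  simp only [commonForm, QuadraticMap.polar, QuadraticMap.ofPolar_apply, ← map_sub,
    Submodule.coe_add]
  congr 1
  by_cases hb : b = 0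
  · simp [hb]
  · field_simp
    ring

theorem commonForm_nondegenerate (h2 : (2 : F) ≠ 0) {b : F}
    (hb : ∃ t, σ t = s t ∧ Algebra.trace (ZMod p) F (t / b) ≠ 0) (x : eqSubmodule s σ)
    (hx : ∀ y, QuadraticMap.polar (commonForm s σ b) x y = 0) : x = 0 := by
  obtain ⟨t, ht, hne⟩ := hb
  by_contra hx0
  have hx0' : (x : F) ≠ 0 := fun h => hx0 (Subtype.ext h)
  have hx1 : σ (x : F) = s x := x.2
  have := hx ⟨t / x, by rw [mem_eqSubmodule, map_div₀, map_div₀, ht, hx1]⟩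
  rw [polar_commonForm h2, mul_div_cancel₀ _ hx0'] at this
  exact hne this

/-- An involution `s` and a commuting automorphism `σ`, of fixed field `p^m` and common
fixed field `p^d` with `d` odd. -/
structure IsTwistPair [Fintype F] (m d : ℕ) (s σ : F ≃ₐ[ZMod p] F) : Prop where
  odd : p % 2 = 1
  odd_common : d % 2 = 1
  invol : ∀ x, s (s x) = x
  comm : ∀ x, s (σ x) = σ (s x)
  anti : ∀ v, s v = -v → σ v = -v → v = 0
  card_field : Fintype.card F = p ^ (2 * m)
  card_fixed : (Finset.univ.filter fun x => s x = x).card = p ^ m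
  card_common : (Finset.univ.filter fun t => σ t = s t).card = p ^ d

variable [Fintype F] {m d : ℕ}

namespace IsTwistPair

theorem two_ne_zero (h : IsTwistPair m d s σ) : (2 : F) ≠ 0 := two_ne_zero_of_odd p F h.odd

theorem fixed_of_mem (h : IsTwistPair m d s σ) {t : F} (ht : σ t = s t) : s t = t := by
  rw [← sub_eq_zero]
  refine h.anti _ ?_ ?_
  · rw [map_sub, h.invol]; ring
  · rw [map_sub, ← h.comm, ht, h.invol]; ring

theorem le (h : IsTwistPair m d s σ) : d ≤ m := by
  have h1 : (Finset.univ.filter fun t => σ t = s t) ⊆ Finset.univ.filter fun x => s x = x :=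
    fun t ht => Finset.mem_filter.2 ⟨Finset.mem_univ _, h.fixed_of_mem (Finset.mem_filter.1 ht).2⟩
  have h2 := Finset.card_le_card h1
  rw [h.card_fixed, h.card_common] at h2
  exact (Nat.pow_le_pow_iff_right hp.out.one_lt).1 h2

theorem card_eqSubmodule (h : IsTwistPair m d s σ) : Fintype.card (eqSubmodule s σ) = p ^ d := by
  rw [← h.card_common, Fintype.card_subtype]
  congr

theorem finrank_eqSubmodule (h : IsTwistPair m d s σ) :
    Module.finrank (ZMod p) (eqSubmodule s σ) = d := by
  have h3 := Module.card_eq_pow_finrank (K := ZMod p) (V := eqSubmodule s σ)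
  rw [h.card_eqSubmodule, ZMod.card] at h3
  exact (Nat.pow_right_injective hp.out.two_le h3).symm

theorem sum_filter_eq (f : F → ℂ) :
    ∑ t ∈ Finset.univ.filter (fun t => σ t = s t), f t = ∑ t : eqSubmodule s σ, f t :=
  Finset.sum_subtype _ (fun x => by simp [mem_eqSubmodule]) f

/-- The value of `weilSum` on a degenerate pair normalised at `1`. -/
def degenerateSum (s σ : F ≃ₐ[ZMod p] F) (b : F) : ℂ := weilSum s σ (-(b + σ.symm b)) b 0

theorem degenerateSum_eq (h : IsTwistPair m d s σ) {b : F} (hb : s b = b) (hb0 : b ≠ 0) :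
    degenerateSum s σ b =
      -(p : ℂ) ^ m * ∑ t : eqSubmodule s σ, traceChar p F ((t : F) ^ 2 / (2 * b)) := by
  rw [degenerateSum, weilSum_degenerate h.odd h.card_field h.invol h.comm h.anti h.card_fixed hb
    hb0, sum_filter_eq]

theorem degenerateSum_of_orthogonal (h : IsTwistPair m d s σ) {b : F} (hb : s b = b) (hb0 : b ≠ 0)
    (ho : ∀ t, σ t = s t → Algebra.trace (ZMod p) F (t / b) = 0) :
    degenerateSum s σ b = -(p : ℂ) ^ (m + d) := by
  rw [h.degenerateSum_eq hb hb0, Finset.sum_congr rfl (g := fun _ => (1 : ℂ))]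
  · rw [Finset.sum_const, Finset.card_univ, h.card_eqSubmodule]
    simp [pow_add]
  · intro t _
    rw [traceChar_eq_one_iff, ← div_div]
    have ht : σ (t : F) = s t := t.2
    exact ho _ (by simp only [map_div₀, map_pow, map_ofNat, ht])

theorem degenerateSum_of_not_orthogonal (h : IsTwistPair m d s σ) {b : F} (hb : s b = b)
    (hb0 : b ≠ 0) (ho : ¬∀ t, σ t = s t → Algebra.trace (ZMod p) F (t / b) = 0) :
    ∃ ε : ℤ, (ε = 1 ∨ ε = -1) ∧ ∀ c : ZMod p, c ≠ 0 →
      degenerateSum s σ ((algebraMap (ZMod p) F c)⁻¹ * b) =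
        (ε * quadraticChar (ZMod p) c : ℤ) * sqrtStar p * (p : ℂ) ^ (m + (d - 1) / 2) := by
  have ho' : ∃ t, σ t = s t ∧ Algebra.trace (ZMod p) F (t / b) ≠ 0 := by
    simpa only [not_forall, exists_prop] using ho
  obtain ⟨ε, hε, h1⟩ := sum_stdAddChar_quadraticForm h.odd (commonForm s σ b)
    (commonForm_nondegenerate h.two_ne_zero ho')
  obtain ⟨δ, hδ, h3⟩ := sqrtStar_pow_odd (p := p) h.odd h.odd_common
  refine ⟨-(ε * δ), ?_, fun c hc => ?_⟩
  · rcases hε with rfl | rfl <;> rcases hδ with rfl | rfl <;> simp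
  · have hc' : algebraMap (ZMod p) F c ≠ 0 := by simpa using hc
    rw [h.degenerateSum_eq (by rw [map_mul, map_inv₀, AlgEquiv.commutes, hb])
      (mul_ne_zero (inv_ne_zero hc') hb0)]
    have h4 : ∑ t : eqSubmodule s σ,
        traceChar p F ((t : F) ^ 2 / (2 * ((algebraMap (ZMod p) F c)⁻¹ * b))) =
        ∑ t, ZMod.stdAddChar (c * commonForm s σ b t) := by
      refine Finset.sum_congr rfl fun t _ => ?_
      rw [traceChar_apply, commonForm, QuadraticMap.ofPolar_apply, ← smul_eq_mul c, ← map_smul,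
        Algebra.smul_def]
      congr 2
      field_simp
    have h5 : (quadraticChar (ZMod p) c : ℂ) ^ d = quadraticChar (ZMod p) c := by
      rcases quadraticChar_dichotomy hc with h6 | h6 <;> rw [h6]
      · simp
      · have := (Nat.odd_iff.2 h.odd_common).neg_one_pow (α := ℂ)
        simpa using this
    rw [h4, h1 c hc, h.finrank_eqSubmodule, h5, h3, pow_add]
    push_cast
    ring

theorem neg_pow_ne (h : IsTwistPair m d s σ) {ε : ℤ} (hε : ε = 1 ∨ ε = -1) :
    (ε : ℂ) * sqrtStar p * (p : ℂ) ^ (m + (d - 1) / 2) ≠ -(p : ℂ) ^ (m + d) := by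
  intro he
  have h1 := congrArg (fun z => ‖z ^ 2‖) he
  have h3 : (ε : ℂ) ^ 2 = 1 := by rcases hε with rfl | rfl <;> simp
  simp only [mul_pow, h3, sqrtStar_sq h.odd, neg_sq, ← pow_mul] at h1
  simp only [one_mul, norm_mul, norm_pow, norm_neg, norm_one, one_pow, Complex.norm_natCast,
    ← pow_succ'] at h1
  have h4 : (p : ℕ) ^ ((m + (d - 1) / 2) * 2 + 1) = p ^ ((m + d) * 2) := by exact_mod_cast h1
  have h5 := Nat.pow_right_injective hp.out.two_le h4
  have := h.odd_common
  omega

theorem card_orthogonal (h : IsTwistPair m d s σ) :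
    (Finset.univ.filter fun b : F => s b = b ∧ b ≠ 0 ∧
      ∀ t, σ t = s t → Algebra.trace (ZMod p) F (t / b) = 0).card = p ^ (m - d) - 1 := by
  set H := Finset.univ.filter fun z : F => s z = z ∧
    ∀ t, σ t = s t → Algebra.trace (ZMod p) F (t * z) = 0 with hH
  have h1 : H.card * p ^ d = p ^ m := by
    have h3 : ∑ z ∈ Finset.univ.filter (fun x => s x = x), ∑ t : eqSubmodule s σ,
        traceChar p F (z * t) = (p : ℂ) ^ m := by
      rw [Finset.sum_comm, Finset.sum_eq_single 0]
      · simp [h.card_fixed]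
      · intro t _ ht
        exact sum_fixed_traceChar_mul h.two_ne_zero h.invol (h.fixed_of_mem t.2)
          fun h0 => ht (Subtype.ext h0)
      · simp
    have h4 : ∀ z, ∑ t : eqSubmodule s σ, traceChar p F (z * t) =
        if ∀ t, σ t = s t → Algebra.trace (ZMod p) F (t * z) = 0 then (p : ℂ) ^ d else 0 := by
      intro z
      let χ : AddChar (eqSubmodule s σ) ℂ := (traceChar p F).compAddMonoidHom
        ((LinearMap.mulLeft (ZMod p) z).comp (eqSubmodule s σ).subtype).toAddMonoidHom
      have h5 : χ = 0 ↔ ∀ t, σ t = s t → Algebra.trace (ZMod p) F (t * z) = 0 := by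
        rw [DFunLike.ext_iff]
        constructor
        · intro h6 t ht
          have h7 := h6 ⟨t, ht⟩
          rw [mul_comm, ← traceChar_eq_one_iff]
          exact h7
        · intro h6 t
          have h7 := h6 t t.2
          rw [mul_comm, ← traceChar_eq_one_iff] at h7
          exact h7
      have h8 := AddChar.sum_eq_ite χ
      rw [h.card_eqSubmodule] at h8
      simp only [← h5]
      exact_mod_cast h8
    simp only [h4] at h3
    rw [← Finset.sum_filter, Finset.filter_filter, Finset.sum_const, nsmul_eq_mul] at h3
    exact_mod_cast h3
  have h9 : H.card = p ^ (m - d) := by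
    refine Nat.eq_of_mul_eq_mul_right (pow_pos hp.out.pos d) ?_
    rw [h1, ← pow_add, Nat.sub_add_cancel h.le]
  have h0 : (0 : F) ∈ H := by simp [hH]
  rw [← h9, ← Finset.card_erase_of_mem h0]
  refine Finset.card_nbij' (·⁻¹) (·⁻¹) ?_ ?_ ?_ ?_
  · intro b hb
    simp only [Finset.coe_filter, Finset.mem_univ, true_and, Set.mem_ofPred_eq] at hb
    simp only [hH, Finset.coe_erase, Finset.coe_filter, Finset.mem_univ, true_and, Set.mem_sdiff,
      Set.mem_ofPred_eq, Set.mem_singleton_iff, inv_eq_zero, map_inv₀, hb.1, ← div_eq_mul_inv]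
    exact ⟨hb.2.2, hb.2.1⟩
  · intro b hb
    simp only [hH, Finset.coe_erase, Finset.coe_filter, Finset.mem_univ, true_and, Set.mem_sdiff,
      Set.mem_ofPred_eq, Set.mem_singleton_iff] at hb
    simp only [Finset.coe_filter, Finset.mem_univ, true_and, Set.mem_ofPred_eq, map_inv₀, hb.1.1,
      div_inv_eq_mul, ne_eq, inv_eq_zero]
    exact ⟨hb.2, hb.1.2⟩
  · intro b _; simp
  · intro b _; simp

/-- The possible degenerate sums. -/
theorem degenerateSum_cases (h : IsTwistPair m d s σ) {b : F} (hb : s b = b) (hb0 : b ≠ 0) :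
    degenerateSum s σ b = -(p : ℂ) ^ (m + d) ∨ ∃ ε : ℤ, (ε = 1 ∨ ε = -1) ∧
      degenerateSum s σ b = ε * sqrtStar p * (p : ℂ) ^ (m + (d - 1) / 2) := by
  by_cases ho : ∀ t, σ t = s t → Algebra.trace (ZMod p) F (t / b) = 0
  · exact Or.inl (h.degenerateSum_of_orthogonal hb hb0 ho)
  · obtain ⟨ε, hε, h1⟩ := h.degenerateSum_of_not_orthogonal hb hb0 ho
    refine Or.inr ⟨ε, hε, ?_⟩
    simpa using h1 1 one_ne_zero

theorem degenerateSum_eq_neg_pow_iff (h : IsTwistPair m d s σ) {b : F} (hb : s b = b)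
    (hb0 : b ≠ 0) : degenerateSum s σ b = -(p : ℂ) ^ (m + d) ↔
      ∀ t, σ t = s t → Algebra.trace (ZMod p) F (t / b) = 0 := by
  refine ⟨fun h3 => ?_, h.degenerateSum_of_orthogonal hb hb0⟩
  by_contra ho
  obtain ⟨ε, hε, h1⟩ := h.degenerateSum_of_not_orthogonal hb hb0 ho
  have h4 := h1 1 one_ne_zero
  rw [map_one, inv_one, one_mul, map_one, mul_one, h3] at h4
  exact h.neg_pow_ne hε h4.symm

theorem card_degenerateSum_eq_neg_pow (h : IsTwistPair m d s σ) :
    (Finset.univ.filter fun b : F => (s b = b ∧ b ≠ 0) ∧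
      degenerateSum s σ b = -(p : ℂ) ^ (m + d)).card = p ^ (m - d) - 1 := by
  rw [← h.card_orthogonal]
  congr 1
  ext b
  simp only [Finset.mem_filter, Finset.mem_univ, true_and, and_assoc]
  refine and_congr_right fun hb => and_congr_right fun hb0 => ?_
  exact h.degenerateSum_eq_neg_pow_iff hb hb0

theorem card_degenerateSum_eq_sqrtStar (h : IsTwistPair m d s σ) {ε : ℤ} (hε : ε = 1 ∨ ε = -1) :
    2 * (Finset.univ.filter fun b : F => (s b = b ∧ b ≠ 0) ∧
      degenerateSum s σ b = ε * sqrtStar p * (p : ℂ) ^ (m + (d - 1) / 2)).card =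
        p ^ m - p ^ (m - d) := by
  have hP : sqrtStar p * (p : ℂ) ^ (m + (d - 1) / 2) ≠ 0 :=
    mul_ne_zero (sqrtStar_ne_zero h.odd) (pow_ne_zero _ (by exact_mod_cast hp.out.ne_zero))
  set B : ℤ → Finset F := fun ε => Finset.univ.filter fun b : F => (s b = b ∧ b ≠ 0) ∧
      degenerateSum s σ b = ε * sqrtStar p * (p : ℂ) ^ (m + (d - 1) / 2) with hB
  obtain ⟨u, hu⟩ := quadraticChar_exists_neg_one (F := ZMod p) (by
    rw [ZMod.ringChar_zmod_n]; have := h.odd; omega)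
  have hu0 : u ≠ 0 := by rintro rfl; simp at hu
  have hu0' : algebraMap (ZMod p) F u ≠ 0 := by simpa using hu0
  have hle : ∀ ε : ℤ, ε = 1 ∨ ε = -1 → (B ε).card ≤ (B (-ε)).card := by
    intro ε hε
    refine Finset.card_le_card_of_injOn (fun b => (algebraMap (ZMod p) F u)⁻¹ * b) ?_
      (fun x _ y _ hxy => mul_left_cancel₀ (inv_ne_zero hu0') hxy)
    intro b hb
    simp only [hB, Finset.coe_filter, Finset.mem_univ, true_and, Set.mem_ofPred_eq] at hb ⊢
    obtain ⟨⟨hb1, hb0⟩, hb2⟩ := hb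
    refine ⟨⟨by rw [map_mul, map_inv₀, AlgEquiv.commutes, hb1],
      mul_ne_zero (inv_ne_zero hu0') hb0⟩, ?_⟩
    obtain ⟨δ, hδ, h1⟩ := h.degenerateSum_of_not_orthogonal hb1 hb0 fun ho =>
      h.neg_pow_ne hε (hb2.symm.trans (h.degenerateSum_of_orthogonal hb1 hb0 ho))
    have h3 := h1 1 one_ne_zero
    rw [map_one, inv_one, one_mul, map_one, mul_one, hb2, mul_assoc, mul_assoc] at h3
    have h4 : (ε : ℂ) = δ := mul_right_cancel₀ hP h3
    rw [h1 u hu0, hu]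
    push_cast
    rw [h4]
    ring
  have heq : (B 1).card = (B (-1)).card :=
    le_antisymm (hle 1 (Or.inl rfl)) (by simpa using hle (-1) (Or.inr rfl))
  have hunion : (Finset.univ.filter fun x => s x = x).erase 0 =
      (Finset.univ.filter fun b : F => (s b = b ∧ b ≠ 0) ∧
        degenerateSum s σ b = -(p : ℂ) ^ (m + d)) ∪ (B 1 ∪ B (-1)) := by
    ext b
    simp only [hB, Finset.mem_erase, Finset.mem_filter, Finset.mem_univ, true_and,
      Finset.mem_union, ← and_or_left, and_comm (a := b ≠ 0)]
    refine ⟨fun hb => ⟨hb, ?_⟩, fun hb => hb.1⟩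
    rcases h.degenerateSum_cases hb.1 hb.2 with h1 | ⟨δ, rfl | rfl, h1⟩
    · exact Or.inl h1
    · exact Or.inr (Or.inl h1)
    · exact Or.inr (Or.inr h1)
  have hd1 : Disjoint (B 1) (B (-1)) := by
    rw [Finset.disjoint_left]
    intro b h1 h3
    simp only [hB, Finset.mem_filter, Finset.mem_univ, true_and] at h1 h3
    have h4 := h1.2.symm.trans h3.2
    rw [mul_assoc, mul_assoc] at h4
    have h5 := mul_right_cancel₀ hP h4
    norm_num at h5
  have hd2 : Disjoint (Finset.univ.filter fun b : F => (s b = b ∧ b ≠ 0) ∧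
        degenerateSum s σ b = -(p : ℂ) ^ (m + d)) (B 1 ∪ B (-1)) := by
    rw [Finset.disjoint_left]
    intro b h1 h3
    simp only [hB, Finset.mem_union, Finset.mem_filter, Finset.mem_univ, true_and] at h1 h3
    rcases h3 with h3 | h3
    · exact h.neg_pow_ne (Or.inl rfl) (h3.2.symm.trans h1.2)
    · exact h.neg_pow_ne (Or.inr rfl) (h3.2.symm.trans h1.2)
  have hcard := congrArg Finset.card hunion
  rw [Finset.card_union_of_disjoint hd2, Finset.card_union_of_disjoint hd1,
    Finset.card_erase_of_mem (by simp), h.card_fixed, h.card_degenerateSum_eq_neg_pow] at hcard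
  have h6 : 1 ≤ p ^ (m - d) := Nat.one_le_pow _ _ hp.out.pos
  rcases hε with rfl | rfl
  · change 2 * (B 1).card = _
    omega
  · change 2 * (B (-1)).card = _
    omega

end IsTwistPair

end GaussSum

section Distribution

theorem norm_sqrtStar_sq {p : ℕ} (hodd : p % 2 = 1) : ‖sqrtStar p‖ ^ 2 = p := by
  rw [← norm_pow, sqrtStar_sq hodd]
  simp

/-- The irrational values of the exponential sums. -/
def sqrtValue (p m d : ℕ) (ε : ℤ) : ℂ := ε * sqrtStar p * (p : ℂ) ^ (m + (d - 1) / 2)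

theorem norm_sqrtValue_sq {p m d : ℕ} (hodd : p % 2 = 1) (hd : d % 2 = 1) {ε : ℤ}
    (hε : ε = 1 ∨ ε = -1) : ‖sqrtValue p m d ε‖ ^ 2 = (p : ℝ) ^ (2 * m + d) := by
  have h1 : ‖(ε : ℂ)‖ = 1 := by rcases hε with rfl | rfl <;> simp
  rw [sqrtValue, norm_mul, norm_mul, h1, one_mul, mul_pow, norm_sqrtStar_sq hodd, norm_pow,
    Complex.norm_natCast, ← pow_mul, ← pow_succ']
  congr 1
  omega

theorem norm_pow_sq (p a : ℕ) : ‖(p : ℂ) ^ a‖ ^ 2 = (p : ℝ) ^ (2 * a) := by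
  rw [norm_pow, Complex.norm_natCast, ← pow_mul, mul_comm]

theorem norm_neg_pow_sq (p a : ℕ) : ‖-(p : ℂ) ^ a‖ ^ 2 = (p : ℝ) ^ (2 * a) := by
  rw [norm_neg, norm_pow_sq]

theorem ne_of_norm_sq {p : ℕ} [hp : Fact p.Prime] {v w : ℂ} {a b : ℕ}
    (hv : ‖v‖ ^ 2 = (p : ℝ) ^ a) (hw : ‖w‖ ^ 2 = (p : ℝ) ^ b) (hab : a ≠ b) : v ≠ w := by
  rintro rfl
  have h1 : p ^ a = p ^ b := by exact_mod_cast hv.symm.trans hw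
  exact hab (Nat.pow_right_injective hp.out.two_le h1)

theorem ne_zero_of_norm_sq {p : ℕ} [hp : Fact p.Prime] {v : ℂ} {a : ℕ}
    (hv : ‖v‖ ^ 2 = (p : ℝ) ^ a) : v ≠ 0 := by
  rintro rfl
  have : (p : ℝ) ^ a ≠ 0 := pow_ne_zero _ (by exact_mod_cast hp.out.ne_zero)
  simp at hv
  exact this hv.symm

theorem neg_pow_add_ne_pow_two_mul {p m d : ℕ} [hp : Fact p.Prime] :
    -(p : ℂ) ^ (m + d) ≠ (p : ℂ) ^ (2 * m) := by
  intro he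
  have h7 : (p : ℤ) ^ (2 * m) + (p : ℤ) ^ (m + d) = 0 := by
    have : ((p : ℂ) ^ (2 * m) + (p : ℂ) ^ (m + d)) = 0 := by rw [← he]; ring
    exact_mod_cast this
  have : (0 : ℤ) < p := by exact_mod_cast hp.out.pos
  have h8 : 0 < (p : ℤ) ^ (2 * m) + (p : ℤ) ^ (m + d) := by positivity
  exact h8.ne' h7

variable {p : ℕ} [hp : Fact p.Prime] {F : Type*} [Field F] [Algebra (ZMod p) F]
  {s σ : F ≃ₐ[ZMod p] F}

theorem coeff_ne_zero {α β x : F} (hx : twistedPolar s σ α β x = 0) (hx0 : x ≠ 0)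
    (hab : (α, β) ≠ 0) : β * (x * σ x) ≠ 0 := by
  intro hb
  have hσx : σ x ≠ 0 := by simpa using hx0
  have hsx : s x ≠ 0 := by simpa using hx0
  have hβ : β = 0 := (mul_eq_zero.1 hb).resolve_right (mul_ne_zero hx0 hσx)
  rw [twistedPolar_apply, hβ] at hx
  simp only [zero_mul, map_zero, add_zero] at hx
  exact hab (Prod.ext ((mul_eq_zero.1 hx).resolve_right hsx) hβ)

variable [Fintype F] {m d : ℕ}

/-- The size of the radical of a twisted form. -/
def radicalCard (s σ : F ≃ₐ[ZMod p] F) (α β : F) : ℕ :=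
  (Finset.univ.filter fun x => twistedPolar s σ α β x = 0).card

/-- The number of pairs whose untwisted sum is `v`. -/
def pairCount (s σ : F ≃ₐ[ZMod p] F) (v : ℂ) : ℕ :=
  (Finset.univ.filter fun ab : F × F => s ab.1 = ab.1 ∧ weilSum s σ ab.1 ab.2 0 = v).card

/-- The number of triples whose sum is `v`. -/
def tripleCount (s σ : F ≃ₐ[ZMod p] F) (v : ℂ) : ℕ :=
  (Finset.univ.filter fun abc : F × F × F =>
    s abc.1 = abc.1 ∧ weilSum s σ abc.1 abc.2.1 abc.2.2 = v).card

theorem weilSum_zero : weilSum s σ 0 0 0 = Fintype.card F := by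
  simp [weilSum, twistedForm]

namespace IsTwistPair

theorem pos_common (h : IsTwistPair m d s σ) : 0 < d := by have := h.odd_common; omega

theorem radicalCard_eq (h : IsTwistPair m d s σ) {α β : F} (hα : s α = α) {e : ℕ}
    (hT : ‖weilSum s σ α β 0‖ ^ 2 = (p : ℝ) ^ (2 * m + e)) : radicalCard s σ α β = p ^ e := by
  have h1 := weilSum_mul_conj (σ := σ) h.two_ne_zero h.invol hα β
  rw [Complex.mul_conj, Complex.normSq_eq_norm_sq, hT, h.card_field, pow_add] at h1
  have h3 : p ^ (2 * m) * p ^ e = p ^ (2 * m) * radicalCard s σ α β := by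
    rw [radicalCard]; exact_mod_cast h1
  exact (Nat.eq_of_mul_eq_mul_left (pow_pos hp.out.pos _) h3).symm

theorem weilSum_eq_degenerateSum (h : IsTwistPair m d s σ) {α β x : F} (hα : s α = α)
    (hx : twistedPolar s σ α β x = 0) (hx0 : x ≠ 0) :
    weilSum s σ α β 0 = degenerateSum s σ (β * (x * σ x)) := by
  rw [← weilSum_scale α β hx0, degenerateSum,
    (apply_eq_self_of_twistedPolar_eq_zero h.invol h.comm h.anti hα hx).2]

/-- The possible values of the untwisted sums. -/
theorem weilSum_cases (h : IsTwistPair m d s σ) {α : F} (hα : s α = α) (β : F) :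
    weilSum s σ α β 0 = (p : ℂ) ^ m ∨ weilSum s σ α β 0 = -(p : ℂ) ^ m ∨
    weilSum s σ α β 0 = sqrtValue p m d 1 ∨ weilSum s σ α β 0 = sqrtValue p m d (-1) ∨
    weilSum s σ α β 0 = -(p : ℂ) ^ (m + d) ∨
    ((α, β) = 0 ∧ weilSum s σ α β 0 = (p : ℂ) ^ (2 * m)) := by
  by_cases hab : (α, β) = 0
  · obtain ⟨rfl, rfl⟩ : α = 0 ∧ β = 0 := Prod.ext_iff.1 hab
    refine Or.inr (Or.inr (Or.inr (Or.inr (Or.inr ⟨hab, ?_⟩))))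
    rw [weilSum_zero, h.card_field, Nat.cast_pow]
  by_cases hker : ∀ x, twistedPolar s σ α β x = 0 → x = 0
  · rcases weilSum_eq_or_eq_neg h.odd h.card_field h.invol hα β hker with h1 | h1 <;> simp [h1]
  · obtain ⟨x, hx, hx0⟩ : ∃ x, twistedPolar s σ α β x = 0 ∧ x ≠ 0 := by
      simpa only [not_forall, exists_prop] using hker
    rw [h.weilSum_eq_degenerateSum hα hx hx0]
    rcases h.degenerateSum_cases
      (apply_eq_self_of_twistedPolar_eq_zero h.invol h.comm h.anti hα hx).1
      (coeff_ne_zero hx hx0 hab) with h1 | ⟨ε, rfl | rfl, h1⟩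
    · simp [h1]
    · exact Or.inr (Or.inr (Or.inl h1))
    · exact Or.inr (Or.inr (Or.inr (Or.inl h1)))

/-- Counting degenerate pairs together with a nonzero vector of the radical. -/
theorem pairCount_mul (h : IsTwistPair m d s σ) {v : ℂ} {e : ℕ}
    (hv : ‖v‖ ^ 2 = (p : ℝ) ^ (2 * m + e)) (hv0 : v ≠ (p : ℂ) ^ (2 * m)) :
    pairCount s σ v * (p ^ e - 1) = (p ^ (2 * m) - 1) *
      (Finset.univ.filter fun b : F => (s b = b ∧ b ≠ 0) ∧ degenerateSum s σ b = v).card := by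
  have h1 : ∀ ab ∈ Finset.univ.filter
      (fun ab : F × F => s ab.1 = ab.1 ∧ weilSum s σ ab.1 ab.2 0 = v),
      ((Finset.univ.filter fun x => twistedPolar s σ ab.1 ab.2 x = 0).erase 0).card =
        p ^ e - 1 := by
    intro ab hab
    obtain ⟨ha, hT⟩ := (Finset.mem_filter.1 hab).2
    rw [Finset.card_erase_of_mem (by simp)]
    have := h.radicalCard_eq ha (hT ▸ hv)
    rw [radicalCard] at this
    rw [this]
  have h3 : ((Finset.univ : Finset F).erase 0).card = p ^ (2 * m) - 1 := by
    rw [Finset.card_erase_of_mem (Finset.mem_univ _), Finset.card_univ, h.card_field]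
  rw [pairCount, ← smul_eq_mul, ← Finset.sum_const, ← Finset.sum_congr rfl h1, ← Finset.card_sigma,
    ← h3, ← Finset.card_product]
  refine Finset.card_nbij' (fun t => (t.2, t.1.2 * (t.2 * σ t.2)))
    (fun u => ⟨(-(u.2 + σ.symm u.2) / (u.1 * s u.1), u.2 / (u.1 * σ u.1)), u.1⟩) ?_ ?_ ?_ ?_
  · rintro ⟨⟨α, β⟩, x⟩ ht
    simp only [Finset.coe_sigma, Set.mem_sigma_iff, Finset.coe_filter, Finset.mem_univ, true_and,
      Set.mem_ofPred_eq, Finset.coe_erase, Set.mem_sdiff, Set.mem_singleton_iff] at ht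
    obtain ⟨⟨hα, hT⟩, hx, hx0⟩ := ht
    have hab : (α, β) ≠ 0 := by
      intro hab
      obtain ⟨rfl, rfl⟩ : α = 0 ∧ β = 0 := Prod.ext_iff.1 hab
      rw [weilSum_zero, h.card_field, Nat.cast_pow] at hT
      exact hv0 hT.symm
    simp only [Finset.coe_product, Set.mem_prod, Finset.coe_erase, Finset.coe_univ, Set.mem_sdiff,
      Set.mem_univ, true_and, Set.mem_singleton_iff, Finset.coe_filter, Finset.mem_univ,
      Set.mem_ofPred_eq]
    exact ⟨hx0, ⟨(apply_eq_self_of_twistedPolar_eq_zero h.invol h.comm h.anti hα hx).1,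
      coeff_ne_zero hx hx0 hab⟩, by rw [← h.weilSum_eq_degenerateSum hα hx hx0, hT]⟩
  · rintro ⟨x, b⟩ hu
    simp only [Finset.coe_product, Set.mem_prod, Finset.coe_erase, Finset.coe_univ, Set.mem_sdiff,
      Set.mem_univ, true_and, Set.mem_singleton_iff, Finset.coe_filter, Finset.mem_univ,
      Set.mem_ofPred_eq] at hu
    obtain ⟨hx0, ⟨hb, hb0⟩, hT⟩ := hu
    have hσx : σ x ≠ 0 := by simpa using hx0
    have hsx : s x ≠ 0 := by simpa using hx0
    have hsb : s (σ.symm b) = σ.symm b := by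
      apply σ.injective
      rw [← h.comm, AlgEquiv.apply_symm_apply, hb]
    simp only [Finset.coe_sigma, Set.mem_sigma_iff, Finset.coe_filter, Finset.mem_univ, true_and,
      Set.mem_ofPred_eq, Finset.coe_erase, Set.mem_sdiff, Set.mem_singleton_iff]
    refine ⟨⟨?_, ?_⟩, ?_, hx0⟩
    · rw [map_div₀, map_neg, map_add, map_mul, hb, hsb, h.invol, mul_comm (s x)]
    · rw [← weilSum_scale _ _ hx0, div_mul_cancel₀ _ (mul_ne_zero hx0 hsx),
        div_mul_cancel₀ _ (mul_ne_zero hx0 hσx)]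
      exact hT
    · have hxs : σ.symm x ≠ 0 := by simpa using hx0
      rw [twistedPolar_apply, map_mul, map_div₀, map_mul, AlgEquiv.symm_apply_apply]
      field_simp
      ring
  · rintro ⟨⟨α, β⟩, x⟩ ht
    simp only [Finset.coe_sigma, Set.mem_sigma_iff, Finset.coe_filter, Finset.mem_univ, true_and,
      Set.mem_ofPred_eq, Finset.coe_erase, Set.mem_sdiff, Set.mem_singleton_iff] at ht
    obtain ⟨⟨hα, hT⟩, hx, hx0⟩ := ht
    have hσx : σ x ≠ 0 := by simpa using hx0
    have hsx : s x ≠ 0 := by simpa using hx0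
    have h4 := (apply_eq_self_of_twistedPolar_eq_zero h.invol h.comm h.anti hα hx).2
    simp only [← h4]
    rw [mul_div_cancel_right₀ _ (mul_ne_zero hx0 hsx),
      mul_div_cancel_right₀ _ (mul_ne_zero hx0 hσx)]
  · rintro ⟨x, b⟩ hu
    simp only [Finset.coe_product, Set.mem_prod, Finset.coe_erase, Finset.coe_univ, Set.mem_sdiff,
      Set.mem_univ, true_and, Set.mem_singleton_iff] at hu
    have hσx : σ x ≠ 0 := by simpa using hu.1
    simp only
    rw [div_mul_cancel₀ _ (mul_ne_zero hu.1 hσx)]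

/-- The sum of all the untwisted sums. -/
theorem sum_weilSum (h : IsTwistPair m d s σ) :
    ∑ ab ∈ Finset.univ.filter (fun ab : F × F => s ab.1 = ab.1), weilSum s σ ab.1 ab.2 0 =
      (p : ℂ) ^ (3 * m) := by
  have h1 : (Finset.univ.filter fun ab : F × F => s ab.1 = ab.1) =
      (Finset.univ.filter fun a => s a = a) ×ˢ Finset.univ := by
    ext ab; simp
  have h3 : ∀ α, ∑ β, weilSum s σ α β 0 = (p : ℂ) ^ (2 * m) := by
    intro α
    simp only [weilSum]
    rw [Finset.sum_comm, Finset.sum_eq_single 0]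
    · simp [twistedForm, h.card_field]
    · intro x _ hx
      have hσx : σ x ≠ 0 := by simpa using hx
      have h4 := sum_traceChar_mul p (x * σ x)
      rw [if_neg (mul_ne_zero hx hσx)] at h4
      simp only [twistedForm, zero_mul, add_zero, AddChar.map_add_eq_mul, ← Finset.mul_sum]
      simp only [mul_comm _ (x * σ x), h4, mul_zero]
    · simp
  rw [h1, Finset.sum_product, Finset.sum_congr rfl fun a _ => h3 a, Finset.sum_const, h.card_fixed,
    nsmul_eq_mul, Nat.cast_pow, ← pow_add]
  congr 1; ring

/-- Sums over pairs grouped by the value of the untwisted sum. -/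
theorem sum_pairs (h : IsTwistPair m d s σ) {R : Type*} [CommSemiring R] (g : F × F → R)
    (f : ℂ → R) (hg : ∀ ab : F × F, s ab.1 = ab.1 → g ab = f (weilSum s σ ab.1 ab.2 0)) :
    ∑ ab ∈ Finset.univ.filter (fun ab : F × F => s ab.1 = ab.1), g ab =
      pairCount s σ ((p : ℂ) ^ m) * f ((p : ℂ) ^ m) +
      (pairCount s σ (-(p : ℂ) ^ m) * f (-(p : ℂ) ^ m) +
      (pairCount s σ (sqrtValue p m d 1) * f (sqrtValue p m d 1) +
      (pairCount s σ (sqrtValue p m d (-1)) * f (sqrtValue p m d (-1)) +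
      (pairCount s σ (-(p : ℂ) ^ (m + d)) * f (-(p : ℂ) ^ (m + d)) +
      pairCount s σ ((p : ℂ) ^ (2 * m)) * f ((p : ℂ) ^ (2 * m)))))) := by
  have hd := h.odd_common
  have hdm := h.le
  have h1 := norm_pow_sq p m
  have h2 := norm_neg_pow_sq p m
  have h3 := norm_sqrtValue_sq (p := p) (m := m) h.odd hd (Or.inl rfl)
  have h4 := norm_sqrtValue_sq (p := p) (m := m) h.odd hd (Or.inr rfl)
  have h5 := norm_neg_pow_sq p (m + d)
  have h6 := norm_pow_sq p (2 * m)
  have hne : ∀ {v : ℂ}, v ≠ 0 → v ≠ -v := fun hv he => hv (self_eq_neg.1 he)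
  have n12 := hne (ne_zero_of_norm_sq h1)
  have n34 : sqrtValue p m d 1 ≠ sqrtValue p m d (-1) := by
    have : sqrtValue p m d (-1) = -sqrtValue p m d 1 := by simp [sqrtValue]
    rw [this]
    exact hne (ne_zero_of_norm_sq h3)
  set V : Finset ℂ := {(p : ℂ) ^ m, -(p : ℂ) ^ m, sqrtValue p m d 1, sqrtValue p m d (-1),
    -(p : ℂ) ^ (m + d), (p : ℂ) ^ (2 * m)} with hV
  have hmaps : ∀ ab ∈ Finset.univ.filter (fun ab : F × F => s ab.1 = ab.1),
      weilSum s σ ab.1 ab.2 0 ∈ V := by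
    intro ab hab
    have := h.weilSum_cases (Finset.mem_filter.1 hab).2 ab.2
    simp only [hV, Finset.mem_insert, Finset.mem_singleton]
    tauto
  rw [← Finset.sum_fiberwise_of_maps_to hmaps]
  have hfib : ∀ v ∈ V, ∑ ab ∈ (Finset.univ.filter (fun ab : F × F => s ab.1 = ab.1)).filter
      (fun ab => weilSum s σ ab.1 ab.2 0 = v), g ab = pairCount s σ v * f v := by
    intro v _
    rw [Finset.sum_congr rfl (g := fun _ => f v), Finset.sum_const, nsmul_eq_mul, pairCount,
      Finset.filter_filter]
    intro ab hab
    rw [Finset.mem_filter, Finset.mem_filter] at hab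
    rw [hg ab hab.1.2, hab.2]
  rw [Finset.sum_congr rfl hfib, hV]
  rw [Finset.sum_insert, Finset.sum_insert, Finset.sum_insert, Finset.sum_insert,
    Finset.sum_insert, Finset.sum_singleton]
  · simpa using neg_pow_add_ne_pow_two_mul
  · simp only [Finset.mem_insert, Finset.mem_singleton, not_or]
    exact ⟨ne_of_norm_sq h4 h5 (by omega), ne_of_norm_sq h4 h6 (by omega)⟩
  · simp only [Finset.mem_insert, Finset.mem_singleton, not_or]
    exact ⟨n34, ne_of_norm_sq h3 h5 (by omega), ne_of_norm_sq h3 h6 (by omega)⟩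
  · simp only [Finset.mem_insert, Finset.mem_singleton, not_or]
    exact ⟨ne_of_norm_sq h2 h3 (by omega), ne_of_norm_sq h2 h4 (by omega),
      ne_of_norm_sq h2 h5 (by omega), ne_of_norm_sq h2 h6 (by omega)⟩
  · simp only [Finset.mem_insert, Finset.mem_singleton, not_or]
    exact ⟨n12, ne_of_norm_sq h1 h3 (by omega), ne_of_norm_sq h1 h4 (by omega),
      ne_of_norm_sq h1 h5 (by omega), ne_of_norm_sq h1 h6 (by omega)⟩

end IsTwistPair

end Distribution

section TripleCounts

/-- Multiplying by a root of unity is injective among numbers of real square. -/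
theorem eq_of_stdAddChar_mul_eq {p : ℕ} [NeZero p] (hodd : p % 2 = 1) {v w : ℂ}
    (hv : (v ^ 2).im = 0) (hw : (w ^ 2).im = 0) {c : ZMod p} (h : ZMod.stdAddChar c * w = v) :
    w = v := by
  have h1 : w ^ p = v ^ p := by
    rw [← h, mul_pow, ← AddChar.map_nsmul_eq_pow, nsmul_eq_mul, CharP.cast_eq_zero, zero_mul,
      AddChar.map_zero_eq_one, one_mul]
  have hr : ∀ z : ℂ, (z ^ 2).im = 0 → z ^ 2 = ((z ^ 2).re : ℂ) := fun z hz =>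
    Complex.ext (by simp) (by simp [hz])
  have h3 : (w ^ 2).re = (v ^ 2).re := by
    apply (Nat.odd_iff.2 hodd).strictMono_pow.injective
    have h4 : (w ^ 2) ^ p = (v ^ 2) ^ p := by rw [pow_right_comm, h1, pow_right_comm]
    rw [hr w hw, hr v hv] at h4
    exact_mod_cast h4
  have h5 : w ^ 2 = v ^ 2 := by rw [hr w hw, hr v hv, h3]
  rcases sq_eq_sq_iff_eq_or_eq_neg.1 h5 with h6 | h6
  · exact h6
  · rw [h6, (Nat.odd_iff.2 hodd).neg_pow, neg_eq_self, pow_eq_zero_iff (NeZero.ne p)] at h1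
    rw [h6, h1, neg_zero]

theorem im_sqrtValue_sq {p m d : ℕ} (hodd : p % 2 = 1) (ε : ℤ) :
    (sqrtValue p m d ε ^ 2).im = 0 := by
  have : sqrtValue p m d ε ^ 2 =
      ((ε ^ 2 * ((-1) ^ (p / 2) * p) * ((p : ℤ) ^ (m + (d - 1) / 2)) ^ 2 : ℤ) : ℂ) := by
    rw [sqrtValue, mul_pow, mul_pow, sqrtStar_sq hodd]
    push_cast
    ring
  rw [this, Complex.intCast_im]

theorem im_intCast_sq (r : ℤ) : (((r : ℂ)) ^ 2).im = 0 := by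
  rw [← Int.cast_pow, Complex.intCast_im]

theorem sqrtValue_eq_sum {p : ℕ} [hp : Fact p.Prime] (hodd : p % 2 = 1) (m d : ℕ) (ε : ℤ) :
    sqrtValue p m d ε = ∑ c : ZMod p,
      ((ε * quadraticChar (ZMod p) c * (p : ℤ) ^ (m + (d - 1) / 2) : ℤ) : ℂ) *
        ZMod.stdAddChar c := by
  rw [sqrtValue, sqrtStar_eq_sum hodd, Finset.mul_sum, Finset.sum_mul]
  refine Finset.sum_congr rfl fun c _ => ?_
  push_cast
  ring

theorem intCast_eq_sum {p : ℕ} [hp : Fact p.Prime] (r : ℤ) :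
    (r : ℂ) = ∑ c : ZMod p, ((if c = 0 then r else 0 : ℤ) : ℂ) * ZMod.stdAddChar c := by
  rw [Finset.sum_eq_single 0]
  · simp
  · intro c _ hc; simp [hc]
  · simp

variable {p : ℕ} [hp : Fact p.Prime] {F : Type*} [Field F] [Algebra (ZMod p) F]
  {s σ : F ≃ₐ[ZMod p] F} [Fintype F] {m d : ℕ}

namespace IsTwistPair

theorem im_weilSum_sq (h : IsTwistPair m d s σ) {α : F} (hα : s α = α) (β : F) :
    (weilSum s σ α β 0 ^ 2).im = 0 := by
  rcases h.weilSum_cases hα β with h1 | h1 | h1 | h1 | h1 | ⟨-, h1⟩ <;> rw [h1]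
  · exact_mod_cast im_intCast_sq ((p : ℤ) ^ m)
  · exact_mod_cast im_intCast_sq (-(p : ℤ) ^ m)
  · exact im_sqrtValue_sq h.odd 1
  · exact im_sqrtValue_sq h.odd (-1)
  · exact_mod_cast im_intCast_sq (-(p : ℤ) ^ (m + d))
  · exact_mod_cast im_intCast_sq ((p : ℤ) ^ (2 * m))

/-- Nonzero sums are counted through the polar map. -/
theorem radicalCard_mul_card (h : IsTwistPair m d s σ) {α : F} (hα : s α = α) (β : F)
    (P : ℂ → Prop) (hP : ¬P 0) :
    radicalCard s σ α β * (Finset.univ.filter fun γ => P (weilSum s σ α β γ)).card =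
      (Finset.univ.filter fun y =>
        P (traceChar p F (-twistedForm s σ α β y) * weilSum s σ α β 0)).card := by
  have hmaps : ∀ y ∈ Finset.univ.filter (fun y =>
      P (traceChar p F (-twistedForm s σ α β y) * weilSum s σ α β 0)),
      twistedPolar s σ α β y ∈ Finset.univ.filter fun γ => P (weilSum s σ α β γ) := by
    intro y hy
    rw [Finset.mem_filter] at hy ⊢
    exact ⟨Finset.mem_univ _, by rw [weilSum_twistedPolar h.two_ne_zero h.invol hα]; exact hy.2⟩
  rw [Finset.card_eq_sum_card_fiberwise hmaps, Finset.sum_congr rfl (g := fun _ =>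
    radicalCard s σ α β), Finset.sum_const, smul_eq_mul, mul_comm]
  intro γ hγ
  have hγ' := (Finset.mem_filter.1 hγ).2
  obtain ⟨y₀, hy₀⟩ := exists_twistedPolar_eq_of_weilSum_ne_zero (σ := σ) h.two_ne_zero h.invol hα β
    (γ := γ) (fun h0 => hP (h0 ▸ hγ'))
  refine Finset.card_nbij' (fun y => y - y₀) (fun x => x + y₀) ?_ ?_ ?_ ?_
  · intro y hy
    simp only [Finset.coe_filter, Finset.mem_filter, Finset.mem_univ, true_and,
      Set.mem_ofPred_eq] at hy ⊢
    rw [map_sub, hy.2, hy₀, sub_self]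
  · intro x hx
    simp only [Finset.coe_filter, Finset.mem_filter, Finset.mem_univ, true_and,
      Set.mem_ofPred_eq] at hx ⊢
    have h1 : twistedPolar s σ α β (x + y₀) = γ := by rw [map_add, hx, hy₀, zero_add]
    refine ⟨?_, h1⟩
    rw [← weilSum_twistedPolar h.two_ne_zero h.invol hα, h1]
    exact hγ'
  · intro y _; simp
  · intro y _; simp

theorem tripleCount_eq_sum (v : ℂ) : tripleCount s σ v =
    ∑ ab ∈ Finset.univ.filter (fun ab : F × F => s ab.1 = ab.1),
      (Finset.univ.filter fun γ => weilSum s σ ab.1 ab.2 γ = v).card := by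
  rw [← Finset.card_sigma, tripleCount]
  refine Finset.card_nbij' (fun t => ⟨(t.1, t.2.1), t.2.2⟩) (fun u => (u.1.1, u.1.2, u.2))
    ?_ ?_ ?_ ?_
  · intro t ht
    simpa using ht
  · intro u hu
    simpa using hu
  · intro t _; rfl
  · intro u _; rfl

/-- The multiplicity of a nonzero value in terms of the untwisted multiplicity. -/
theorem tripleCount_mul (h : IsTwistPair m d s σ) {v : ℂ} {e : ℕ}
    (hv : ‖v‖ ^ 2 = (p : ℝ) ^ (2 * m + e)) (hv2 : (v ^ 2).im = 0) (a : ZMod p → ℤ)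
    (ha : v = ∑ c, (a c : ℂ) * ZMod.stdAddChar c) (j : ZMod p) :
    (p : ℤ) ^ e * p * tripleCount s σ (ZMod.stdAddChar j * v) =
      pairCount s σ v * (p * a (-j) + (p : ℤ) ^ (2 * m) - ∑ c, a c) := by
  have hv0 := ne_zero_of_norm_sq hv
  have hψ : ∀ c : ZMod p, ZMod.stdAddChar c ≠ 0 := fun c h0 => by
    have := AddChar.norm_apply (ZMod.stdAddChar (N := p)) c
    rw [h0, norm_zero] at this
    exact zero_ne_one this
  have key : ∀ ab ∈ Finset.univ.filter (fun ab : F × F => s ab.1 = ab.1),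
      (p : ℤ) ^ e * p * ((Finset.univ.filter fun γ =>
        weilSum s σ ab.1 ab.2 γ = ZMod.stdAddChar j * v).card : ℤ) =
      if weilSum s σ ab.1 ab.2 0 = v then p * a (-j) + (p : ℤ) ^ (2 * m) - ∑ c, a c else 0 := by
    rintro ⟨α, β⟩ hab
    have hα : s α = α := (Finset.mem_filter.1 hab).2
    have h1 := h.radicalCard_mul_card hα β (fun w => w = ZMod.stdAddChar j * v)
      (mul_ne_zero (hψ j) hv0).symm
    dsimp only at h1 ⊢
    split_ifs with hT
    · rw [h.radicalCard_eq hα (hT ▸ hv), hT] at h1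
      have h3 : (Finset.univ.filter fun y => traceChar p F (-twistedForm s σ α β y) * v =
          ZMod.stdAddChar j * v) = Finset.univ.filter fun y =>
          Algebra.trace (ZMod p) F (twistedForm s σ α β y) = -j := by
        ext y
        simp only [Finset.mem_filter, Finset.mem_univ, true_and]
        rw [mul_left_inj' hv0, traceChar_apply, ZMod.injective_stdAddChar.eq_iff, map_neg,
          neg_eq_iff_eq_neg]
      rw [h3] at h1
      have h4 := card_level_of_sum_stdAddChar
        (fun y => Algebra.trace (ZMod p) F (twistedForm s σ α β y)) a (by
          rw [← ha, ← hT, weilSum]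
          simp only [zero_mul, add_zero, traceChar_apply]) (-j)
      rw [h.card_field] at h4
      push_cast at h4
      rw [← h4, ← h1]
      push_cast
      ring
    · have h3 : (Finset.univ.filter fun y => traceChar p F (-twistedForm s σ α β y) *
          weilSum s σ α β 0 = ZMod.stdAddChar j * v) = ∅ := by
        rw [Finset.filter_eq_empty_iff]
        intro y _ hy
        apply hT
        refine eq_of_stdAddChar_mul_eq h.odd hv2 (h.im_weilSum_sq hα β)
          (c := -j + Algebra.trace (ZMod p) F (-twistedForm s σ α β y)) ?_
        rw [AddChar.map_add_eq_mul, mul_assoc, ← traceChar_apply, hy, ← mul_assoc,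
          ← AddChar.map_add_eq_mul, neg_add_cancel, AddChar.map_zero_eq_one, one_mul]
      rw [h3, Finset.card_empty, mul_eq_zero] at h1
      rcases h1 with h1 | h1
      · rw [radicalCard, Finset.card_eq_zero, Finset.filter_eq_empty_iff] at h1
        exact absurd (map_zero _) (h1 (Finset.mem_univ 0))
      · rw [h1]; simp
  rw [tripleCount_eq_sum, Nat.cast_sum, Finset.mul_sum, Finset.sum_congr rfl key,
    ← Finset.sum_filter, Finset.sum_const, Finset.filter_filter, nsmul_eq_mul, pairCount]

theorem tripleCount_intCast_mul (h : IsTwistPair m d s σ) {r : ℤ} {e : ℕ}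
    (hv : ‖(r : ℂ)‖ ^ 2 = (p : ℝ) ^ (2 * m + e)) (j : ZMod p) :
    (p : ℤ) ^ e * p * tripleCount s σ (ZMod.stdAddChar j * r) =
      pairCount s σ r * (p * (if j = 0 then r else 0) + (p : ℤ) ^ (2 * m) - r) := by
  have h1 := h.tripleCount_mul hv (im_intCast_sq r) _ (intCast_eq_sum r) j
  simpa using h1

theorem tripleCount_sqrtValue_mul (h : IsTwistPair m d s σ) {ε : ℤ} (hε : ε = 1 ∨ ε = -1)
    (j : ZMod p) :
    (p : ℤ) ^ d * p * tripleCount s σ (ZMod.stdAddChar j * sqrtValue p m d ε) =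
      pairCount s σ (sqrtValue p m d ε) *
        (p * (ε * quadraticChar (ZMod p) (-j) * (p : ℤ) ^ (m + (d - 1) / 2)) +
          (p : ℤ) ^ (2 * m)) := by
  have h1 := h.tripleCount_mul (norm_sqrtValue_sq h.odd h.odd_common hε)
    (im_sqrtValue_sq h.odd ε) _ (sqrtValue_eq_sum h.odd m d ε) j
  rw [h1, ← Finset.sum_mul, ← Finset.mul_sum, quadraticChar_sum_zero (by
    rw [ZMod.ringChar_zmod_n]; have := h.odd; omega)]
  ring

/-- The number of vanishing sums for a fixed pair. -/
theorem card_weilSum_eq_zero (h : IsTwistPair m d s σ) {α : F} (hα : s α = α) (β : F) :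
    ((Finset.univ.filter fun γ => weilSum s σ α β γ = 0).card : ℝ) =
      (p : ℝ) ^ (2 * m) - (p : ℝ) ^ (4 * m) / ‖weilSum s σ α β 0‖ ^ 2 := by
  have hp0 : (p : ℝ) ≠ 0 := by exact_mod_cast hp.out.ne_zero
  have h1 := weilSum_mul_conj (σ := σ) h.two_ne_zero h.invol hα β
  rw [Complex.mul_conj, Complex.normSq_eq_norm_sq, h.card_field, ← radicalCard] at h1
  have h3 : ‖weilSum s σ α β 0‖ ^ 2 = (p : ℝ) ^ (2 * m) * radicalCard s σ α β := by
    exact_mod_cast h1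
  have hκ : (radicalCard s σ α β : ℝ) ≠ 0 := by
    rw [Nat.cast_ne_zero, radicalCard, Finset.card_ne_zero]
    exact ⟨0, by simp⟩
  have hT : weilSum s σ α β 0 ≠ 0 := by
    intro h0
    rw [h0] at h3
    simp [hp0, hκ] at h3
  have h4 : radicalCard s σ α β * (Finset.univ.filter fun γ => weilSum s σ α β γ ≠ 0).card =
      (Finset.univ.filter fun y =>
        traceChar p F (-twistedForm s σ α β y) * weilSum s σ α β 0 ≠ 0).card := by
    convert h.radicalCard_mul_card hα β (fun w => w ≠ 0) (by simp)
  have h5 : (Finset.univ.filter fun y =>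
      traceChar p F (-twistedForm s σ α β y) * weilSum s σ α β 0 ≠ 0) = Finset.univ := by
    rw [Finset.filter_eq_self]
    intro y _
    refine mul_ne_zero (fun h0 => ?_) hT
    have := AddChar.norm_apply (traceChar p F) (-twistedForm s σ α β y)
    rw [h0, norm_zero] at this
    exact zero_ne_one this
  rw [h5, Finset.card_univ, h.card_field] at h4
  have h6 := Finset.card_filter_add_card_filter_not (s := (Finset.univ : Finset F))
    (fun γ => weilSum s σ α β γ = 0)
  rw [Finset.card_univ, h.card_field] at h6
  have h7 : (radicalCard s σ α β : ℝ) *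
      (Finset.univ.filter fun γ => weilSum s σ α β γ ≠ 0).card = (p : ℝ) ^ (2 * m) := by
    exact_mod_cast h4
  have h8 : ((Finset.univ.filter fun γ => weilSum s σ α β γ = 0).card : ℝ) +
      (Finset.univ.filter fun γ => weilSum s σ α β γ ≠ 0).card = (p : ℝ) ^ (2 * m) := by
    exact_mod_cast h6
  have h9 : (p : ℝ) ^ (4 * m) / ‖weilSum s σ α β 0‖ ^ 2 =
      (Finset.univ.filter fun γ => weilSum s σ α β γ ≠ 0).card := by
    rw [h3, div_eq_iff (mul_ne_zero (pow_ne_zero _ hp0) hκ), mul_left_comm,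
      mul_comm _ (radicalCard s σ α β : ℝ), h7, ← pow_add]
    congr 1; ring
  rw [h9, eq_sub_iff_add_eq, h8]

end IsTwistPair

end TripleCounts

section Multiplicities

variable {p : ℕ} [hp : Fact p.Prime] {F : Type*} [Field F] [Algebra (ZMod p) F]
  {s σ : F ≃ₐ[ZMod p] F} [Fintype F] {m d : ℕ}

namespace IsTwistPair

theorem pairCount_pow_two_mul (h : IsTwistPair m d s σ) :
    pairCount s σ ((p : ℂ) ^ (2 * m)) = 1 := by
  have hdm := h.le
  have hd := h.odd_common
  have h6 := norm_pow_sq p (2 * m)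
  rw [pairCount, Finset.card_eq_one]
  refine ⟨0, Finset.ext fun ab => ?_⟩
  simp only [Finset.mem_filter, Finset.mem_univ, true_and, Finset.mem_singleton]
  constructor
  · rintro ⟨hα, hT⟩
    rcases h.weilSum_cases hα ab.2 with h1 | h1 | h1 | h1 | h1 | ⟨h0, -⟩
    · exact absurd (h1.symm.trans hT) (ne_of_norm_sq (norm_pow_sq p m) h6 (by omega))
    · exact absurd (h1.symm.trans hT) (ne_of_norm_sq (norm_neg_pow_sq p m) h6 (by omega))
    · exact absurd (h1.symm.trans hT)
        (ne_of_norm_sq (norm_sqrtValue_sq h.odd hd (Or.inl rfl)) h6 (by omega))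
    · exact absurd (h1.symm.trans hT)
        (ne_of_norm_sq (norm_sqrtValue_sq h.odd hd (Or.inr rfl)) h6 (by omega))
    · exact absurd (h1.symm.trans hT) neg_pow_add_ne_pow_two_mul
    · exact h0
  · rintro rfl
    exact ⟨map_zero s, by rw [Prod.fst_zero, Prod.snd_zero, weilSum_zero, h.card_field,
      Nat.cast_pow]⟩

theorem pairCount_neg_pow (h : IsTwistPair m d s σ) :
    (pairCount s σ (-(p : ℂ) ^ (m + d)) : ℤ) * ((p : ℤ) ^ (2 * d) - 1) =
      ((p : ℤ) ^ (2 * m) - 1) * ((p : ℤ) ^ (m - d) - 1) := by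
  have h1 := h.pairCount_mul (v := -(p : ℂ) ^ (m + d)) (e := 2 * d)
    (by rw [norm_neg_pow_sq]; congr 1; ring) neg_pow_add_ne_pow_two_mul
  rw [h.card_degenerateSum_eq_neg_pow] at h1
  have := congrArg (Nat.cast (R := ℤ)) h1
  have h3 : ∀ a : ℕ, 1 ≤ p ^ a := fun a => Nat.one_le_pow _ _ hp.out.pos
  push_cast [h3] at this
  exact this

theorem pairCount_sqrtValue (h : IsTwistPair m d s σ) {ε : ℤ} (hε : ε = 1 ∨ ε = -1) :
    2 * (pairCount s σ (sqrtValue p m d ε) : ℤ) = ((p : ℤ) ^ (2 * m) - 1) * (p : ℤ) ^ (m - d) := by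
  have hd := h.odd_common
  have hn := norm_sqrtValue_sq (p := p) (m := m) h.odd hd hε
  have h1 := h.pairCount_mul hn (ne_of_norm_sq hn (norm_pow_sq p (2 * m)) (by omega))
  have h4 : 2 * (Finset.univ.filter fun b : F => (s b = b ∧ b ≠ 0) ∧
      degenerateSum s σ b = sqrtValue p m d ε).card = p ^ m - p ^ (m - d) :=
    h.card_degenerateSum_eq_sqrtStar hε
  have h3 : ∀ a : ℕ, 1 ≤ p ^ a := fun a => Nat.one_le_pow _ _ hp.out.pos
  have h5 : p ^ (m - d) ≤ p ^ m := Nat.pow_le_pow_right hp.out.pos (Nat.sub_le _ _)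
  have h6 := congrArg (Nat.cast (R := ℤ)) h1
  have h7 := congrArg (Nat.cast (R := ℤ)) h4
  push_cast [h3, h5] at h6 h7
  have h8 : (p : ℤ) ^ m = (p : ℤ) ^ (m - d) * (p : ℤ) ^ d := by
    rw [← pow_add, Nat.sub_add_cancel h.le]
  have h9 : (p : ℤ) ^ d - 1 ≠ 0 := by
    have : 1 < p ^ d := Nat.one_lt_pow (by omega) hp.out.one_lt
    have : (1 : ℤ) < (p : ℤ) ^ d := by exact_mod_cast this
    exact (sub_pos.2 this).ne'
  refine mul_right_cancel₀ h9 ?_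
  linear_combination 2 * h6 + ((p : ℤ) ^ (2 * m) - 1) * h7 + ((p : ℤ) ^ (2 * m) - 1) * h8

/-- The total number of pairs. -/
theorem pairCount_total (h : IsTwistPair m d s σ) :
    (pairCount s σ ((p : ℂ) ^ m) : ℤ) + pairCount s σ (-(p : ℂ) ^ m) +
      ((p : ℤ) ^ (2 * m) - 1) * (p : ℤ) ^ (m - d) + pairCount s σ (-(p : ℂ) ^ (m + d)) + 1 =
      (p : ℤ) ^ (3 * m) := by
  have h1 := h.sum_pairs (R := ℤ) (fun _ => 1) (fun _ => 1) fun _ _ => rfl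
  have h3 : (Finset.univ.filter fun ab : F × F => s ab.1 = ab.1) =
      (Finset.univ.filter fun a => s a = a) ×ˢ Finset.univ := by
    ext ab; simp
  rw [Finset.sum_const, h3, Finset.card_product, h.card_fixed, Finset.card_univ, h.card_field,
    h.pairCount_pow_two_mul] at h1
  have h4 := h.pairCount_sqrtValue (Or.inl rfl)
  have h5 := h.pairCount_sqrtValue (Or.inr rfl)
  have h6 : (p : ℤ) ^ (3 * m) = (p : ℤ) ^ m * (p : ℤ) ^ (2 * m) := by
    rw [← pow_add]; congr 1; ring
  simp only [nsmul_eq_mul, mul_one] at h1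
  push_cast at h1
  rw [h6, h1]
  linarith

theorem pairCount_diff (h : IsTwistPair m d s σ) :
    (pairCount s σ ((p : ℂ) ^ m) : ℤ) - pairCount s σ (-(p : ℂ) ^ m) =
      (p : ℤ) ^ (2 * m) - (p : ℤ) ^ m + (p : ℤ) ^ d * pairCount s σ (-(p : ℂ) ^ (m + d)) := by
  have h1 := h.sum_pairs (fun ab => weilSum s σ ab.1 ab.2 0) id fun _ _ => rfl
  rw [h.sum_weilSum, h.pairCount_pow_two_mul] at h1
  have h4 := (h.pairCount_sqrtValue (Or.inl rfl)).trans (h.pairCount_sqrtValue (Or.inr rfl)).symm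
  have h5 : pairCount s σ (sqrtValue p m d 1) = pairCount s σ (sqrtValue p m d (-1)) := by
    exact_mod_cast mul_left_cancel₀ _root_.two_ne_zero h4
  have h6 : sqrtValue p m d (-1) = -sqrtValue p m d 1 := by simp [sqrtValue]
  have h7 : (p : ℂ) ^ m ≠ 0 := pow_ne_zero _ (by exact_mod_cast hp.out.ne_zero)
  rw [h5, h6] at h1
  have e1 : (p : ℂ) ^ (3 * m) = (p : ℂ) ^ m * (p : ℂ) ^ (2 * m) := by
    rw [← pow_add]; congr 1; ring
  have e2 : (p : ℂ) ^ (2 * m) = (p : ℂ) ^ m * (p : ℂ) ^ m := by rw [← pow_add]; congr 1; ring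
  have h8 : (pairCount s σ ((p : ℂ) ^ m) : ℂ) - pairCount s σ (-(p : ℂ) ^ m) =
      (p : ℂ) ^ (2 * m) - (p : ℂ) ^ m + (p : ℂ) ^ d * pairCount s σ (-(p : ℂ) ^ (m + d)) := by
    refine mul_left_cancel₀ h7 ?_
    simp only [id, e1, e2, pow_add] at h1 ⊢
    push_cast at h1
    linear_combination -h1
  exact_mod_cast h8

theorem exists_eq_add (h : IsTwistPair m d s σ) : ∃ t r, d = 2 * t + 1 ∧ m = 2 * t + 1 + r := by
  have := h.odd_common
  have := h.le
  exact ⟨d / 2, m - d, by omega, by omega⟩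

theorem pairCount_pow (h : IsTwistPair m d s σ) :
    2 * ((p : ℤ) ^ d + 1) * pairCount s σ ((p : ℂ) ^ m) =
      ((p : ℤ) ^ (2 * m) - 1) * (p : ℤ) ^ d * ((p : ℤ) ^ m + 1) := by
  have h1 := h.pairCount_total
  have h3 := h.pairCount_diff
  have h4 := h.pairCount_neg_pow
  have h8 : (p : ℤ) ^ m = (p : ℤ) ^ (m - d) * (p : ℤ) ^ d := by
    rw [← pow_add, Nat.sub_add_cancel h.le]
  have e1 : (p : ℤ) ^ (3 * m) = ((p : ℤ) ^ m) ^ 3 := by rw [← pow_mul, mul_comm]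
  have e2 : (p : ℤ) ^ (2 * m) = ((p : ℤ) ^ m) ^ 2 := by rw [← pow_mul, mul_comm]
  have e3 : (p : ℤ) ^ (2 * d) = ((p : ℤ) ^ d) ^ 2 := by rw [← pow_mul, mul_comm]
  rw [e1, e2] at h1
  rw [e2] at h3 ⊢
  rw [e2, e3] at h4
  generalize (p : ℤ) ^ (m - d) = M at *
  generalize (p : ℤ) ^ d = D at *
  generalize (p : ℤ) ^ m = Q at *
  linear_combination (D + 1) * h1 + (D + 1) * h3 + h4 + (Q ^ 2 - 1) * h8

theorem pairCount_neg_pow_self (h : IsTwistPair m d s σ) :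
    2 * ((p : ℤ) ^ d - 1) * pairCount s σ (-(p : ℂ) ^ m) =
      ((p : ℤ) ^ m - 1) * (p : ℤ) ^ d *
        ((p : ℤ) ^ (2 * m) - 2 * (p : ℤ) ^ (2 * m - d) + 1) := by
  have h1 := h.pairCount_total
  have h3 := h.pairCount_diff
  have h4 := h.pairCount_neg_pow
  have h8 : (p : ℤ) ^ m = (p : ℤ) ^ (m - d) * (p : ℤ) ^ d := by
    rw [← pow_add, Nat.sub_add_cancel h.le]
  have h9 : (p : ℤ) ^ (2 * m - d) = (p : ℤ) ^ m * (p : ℤ) ^ (m - d) := by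
    rw [← pow_add]; congr 1; have := h.le; omega
  have e1 : (p : ℤ) ^ (3 * m) = ((p : ℤ) ^ m) ^ 3 := by rw [← pow_mul, mul_comm]
  have e2 : (p : ℤ) ^ (2 * m) = ((p : ℤ) ^ m) ^ 2 := by rw [← pow_mul, mul_comm]
  have e3 : (p : ℤ) ^ (2 * d) = ((p : ℤ) ^ d) ^ 2 := by rw [← pow_mul, mul_comm]
  rw [e1, e2] at h1
  rw [h9, e2]
  rw [e2] at h3
  rw [e2, e3] at h4
  generalize (p : ℤ) ^ (m - d) = M at *
  generalize (p : ℤ) ^ d = D at *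
  generalize (p : ℤ) ^ m = Q at *
  linear_combination (D - 1) * h1 - (D - 1) * h3 - h4 + (-2 * Q ^ 2 + 2 * Q + Q ^ 2 - 1) * h8

end IsTwistPair

end Multiplicities

section TripleMultiplicities

variable {p : ℕ} [hp : Fact p.Prime] {F : Type*} [Field F] [Algebra (ZMod p) F]
  {s σ : F ≃ₐ[ZMod p] F} [Fintype F] {m d : ℕ}

namespace IsTwistPair

theorem tripleCount_pow (h : IsTwistPair m d s σ) (j : ZMod p) :
    2 * ((p : ℤ) ^ d + 1) * tripleCount s σ (ZMod.stdAddChar j * (p : ℂ) ^ m) =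
      (p : ℤ) ^ (m + d - 1) * ((p : ℤ) ^ m + 1) * ((p : ℤ) ^ m - 1 + if j = 0 then (p : ℤ) else 0) *
        ((p : ℤ) ^ (2 * m) - 1) := by
  have h1 := h.tripleCount_intCast_mul (r := (p : ℤ) ^ m) (e := 0)
    (by push_cast; exact norm_pow_sq p m) j
  have h3 := h.pairCount_pow
  push_cast at h1
  have hp0 : (p : ℤ) ≠ 0 := by exact_mod_cast hp.out.ne_zero
  have e1 : (p : ℤ) ^ m * (p : ℤ) ^ d = p * (p : ℤ) ^ (m + d - 1) := by
    rw [← pow_add, ← pow_succ']; congr 1; have := h.pos_common; omega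
  have e2 : (p : ℤ) ^ (2 * m) = (p : ℤ) ^ m * (p : ℤ) ^ m := by rw [← pow_add]; congr 1; ring
  have e3 : (p : ℤ) * (if j = 0 then (p : ℤ) ^ m else 0) =
      (p : ℤ) ^ m * if j = 0 then (p : ℤ) else 0 := by split_ifs <;> ring
  refine mul_left_cancel₀ hp0 ?_
  rw [e3, e2] at h1
  rw [e2] at h3 ⊢
  generalize (if j = 0 then (p : ℤ) else 0) = δ at *
  linear_combination 2 * ((p : ℤ) ^ d + 1) * h1 + (p : ℤ) ^ m * ((p : ℤ) ^ m - 1 + δ) * h3 +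
    ((p : ℤ) ^ m + 1) * ((p : ℤ) ^ m - 1 + δ) * ((p : ℤ) ^ m * (p : ℤ) ^ m - 1) * e1

theorem tripleCount_neg_pow_self (h : IsTwistPair m d s σ) (j : ZMod p) :
    2 * ((p : ℤ) ^ d - 1) * tripleCount s σ (ZMod.stdAddChar j * -(p : ℂ) ^ m) =
      (p : ℤ) ^ (m + d - 1) * ((p : ℤ) ^ m - 1) * ((p : ℤ) ^ m + 1 - if j = 0 then (p : ℤ) else 0) *
        ((p : ℤ) ^ (2 * m) - 2 * (p : ℤ) ^ (2 * m - d) + 1) := by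
  have h1 := h.tripleCount_intCast_mul (r := -(p : ℤ) ^ m) (e := 0)
    (by push_cast; exact norm_neg_pow_sq p m) j
  have h3 := h.pairCount_neg_pow_self
  push_cast at h1
  have hp0 : (p : ℤ) ≠ 0 := by exact_mod_cast hp.out.ne_zero
  have e1 : (p : ℤ) ^ m * (p : ℤ) ^ d = p * (p : ℤ) ^ (m + d - 1) := by
    rw [← pow_add, ← pow_succ']; congr 1; have := h.pos_common; omega
  have e2 : (p : ℤ) ^ (2 * m) = (p : ℤ) ^ m * (p : ℤ) ^ m := by rw [← pow_add]; congr 1; ring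
  have e3 : (p : ℤ) * (if j = 0 then -(p : ℤ) ^ m else 0) =
      -(p : ℤ) ^ m * if j = 0 then (p : ℤ) else 0 := by split_ifs <;> ring
  refine mul_left_cancel₀ hp0 ?_
  rw [e3, e2] at h1
  rw [e2] at h3 ⊢
  generalize (if j = 0 then (p : ℤ) else 0) = δ at *
  generalize (p : ℤ) ^ (2 * m - d) = W at *
  linear_combination 2 * ((p : ℤ) ^ d - 1) * h1 + (p : ℤ) ^ m * ((p : ℤ) ^ m + 1 - δ) * h3 +
    ((p : ℤ) ^ m - 1) * ((p : ℤ) ^ m + 1 - δ) * ((p : ℤ) ^ m * (p : ℤ) ^ m - 2 * W + 1) * e1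

theorem tripleCount_sqrtValue (h : IsTwistPair m d s σ) {ε : ℤ} (hε : ε = 1 ∨ ε = -1)
    (j : ZMod p) :
    2 * (tripleCount s σ (ZMod.stdAddChar j * sqrtValue p m d ε) : ℤ) =
      (p : ℤ) ^ (2 * m - (3 * d + 1) / 2) *
        ((p : ℤ) ^ (m - (d + 1) / 2) + ε * quadraticChar (ZMod p) (-j)) *
        ((p : ℤ) ^ (2 * m) - 1) := by
  have h1 := h.tripleCount_sqrtValue_mul hε j
  have h3 := h.pairCount_sqrtValue hε
  have hp0 : (p : ℤ) ≠ 0 := by exact_mod_cast hp.out.ne_zero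
  obtain ⟨t, r, rfl, rfl⟩ := h.exists_eq_add
  have a1 : 2 * (2 * t + 1 + r) - (3 * (2 * t + 1) + 1) / 2 = t + r + r := by omega
  have a2 : 2 * t + 1 + r - (2 * t + 1 + 1) / 2 = t + r := by omega
  have a3 : 2 * t + 1 + r - (2 * t + 1) = r := by omega
  have a4 : (2 * t + 1 - 1) / 2 = t := by omega
  rw [a1, a2]
  rw [a3] at h3
  rw [a4] at h1
  generalize quadraticChar (ZMod p) (-j) = χ at *
  refine mul_left_cancel₀ (mul_ne_zero (pow_ne_zero (2 * t + 1) hp0) hp0) ?_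
  simp only [pow_add, pow_mul', pow_one] at h1 h3 ⊢
  generalize (p : ℤ) ^ t = T at *
  generalize (p : ℤ) ^ r = R at *
  linear_combination 2 * h1 + (p * (ε * χ * (T ^ 2 * p * R * T)) + (T ^ 2 * p * R) ^ 2) * h3

theorem tripleCount_neg_pow (h : IsTwistPair m d s σ) (j : ZMod p) :
    ((p : ℤ) ^ (2 * d) - 1) * tripleCount s σ (ZMod.stdAddChar j * -(p : ℂ) ^ (m + d)) =
      (p : ℤ) ^ (m - d - 1) * ((p : ℤ) ^ (m - d) - 1) * ((p : ℤ) ^ (2 * m) - 1) *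
        ((p : ℤ) ^ (m - d) + 1 - if j = 0 then (p : ℤ) else 0) := by
  have h1 := h.tripleCount_intCast_mul (r := -(p : ℤ) ^ (m + d)) (e := 2 * d)
    (by push_cast; rw [norm_neg_pow_sq]; congr 1; ring) j
  have h3 := h.pairCount_neg_pow
  push_cast at h1
  have hp0 : (p : ℤ) ≠ 0 := by exact_mod_cast hp.out.ne_zero
  have e3 : (p : ℤ) * (if j = 0 then -(p : ℤ) ^ (m + d) else 0) =
      -(p : ℤ) ^ (m + d) * if j = 0 then (p : ℤ) else 0 := by split_ifs <;> ring
  rw [e3] at h1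
  generalize (if j = 0 then (p : ℤ) else 0) = δ at *
  obtain ⟨r, rfl⟩ : ∃ r, m = d + r := ⟨m - d, by have := h.le; omega⟩
  have e4 : (p : ℤ) ^ r * ((p : ℤ) ^ r - 1) = p * (p : ℤ) ^ (r - 1) * ((p : ℤ) ^ r - 1) := by
    rcases Nat.eq_zero_or_pos r with rfl | hr
    · simp
    · rw [← pow_succ', Nat.sub_add_cancel hr]
  rw [Nat.add_sub_cancel_left] at h3 ⊢
  refine mul_left_cancel₀ (mul_ne_zero (pow_ne_zero (2 * d) hp0) hp0) ?_
  simp only [pow_add, pow_mul', mul_pow] at h1 h3 ⊢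
  generalize (p : ℤ) ^ (r - 1) = R' at *
  generalize (p : ℤ) ^ d = D at *
  generalize (p : ℤ) ^ r = R at *
  linear_combination (D ^ 2 - 1) * h1 + (-D * R * D * δ + D ^ 2 * R ^ 2 + D * R * D) * h3 +
    D ^ 2 * (D ^ 2 * R ^ 2 - 1) * (R + 1 - δ) * e4

theorem tripleCount_pow_two_mul (h : IsTwistPair m d s σ) :
    tripleCount s σ ((p : ℂ) ^ (2 * m)) = 1 := by
  have h1 := h.tripleCount_intCast_mul (r := (p : ℤ) ^ (2 * m)) (e := 2 * m)
    (by push_cast; rw [norm_pow_sq]; congr 1; ring) 0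
  push_cast at h1
  have hp0 : (p : ℤ) ≠ 0 := by exact_mod_cast hp.out.ne_zero
  rw [AddChar.map_zero_eq_one, one_mul, h.pairCount_pow_two_mul, if_pos rfl] at h1
  have h3 : (tripleCount s σ ((p : ℂ) ^ (2 * m)) : ℤ) = 1 := by
    refine mul_left_cancel₀ (mul_ne_zero (pow_ne_zero (2 * m) hp0) hp0) ?_
    rw [h1]; push_cast; ring
  exact_mod_cast h3

theorem tripleCount_zero (h : IsTwistPair m d s σ) :
    (tripleCount s σ 0 : ℤ) = ((p : ℤ) ^ (2 * m) - 1) * ((p : ℤ) ^ (3 * m - d) -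
      (p : ℤ) ^ (3 * m - 2 * d) + (p : ℤ) ^ (3 * m - 3 * d) - (p : ℤ) ^ (2 * m - 2 * d) + 1) := by
  have h0 := h.sum_pairs (R := ℝ)
    (fun ab => ((Finset.univ.filter fun γ => weilSum s σ ab.1 ab.2 γ = 0).card : ℝ))
    (fun w => (p : ℝ) ^ (2 * m) - (p : ℝ) ^ (4 * m) / ‖w‖ ^ 2)
    fun ab hab => h.card_weilSum_eq_zero hab ab.2
  rw [← Nat.cast_sum, ← tripleCount_eq_sum, h.pairCount_pow_two_mul, norm_pow_sq, norm_neg_pow_sq,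
    norm_sqrtValue_sq h.odd h.odd_common (Or.inl rfl),
    norm_sqrtValue_sq h.odd h.odd_common (Or.inr rfl), norm_neg_pow_sq, norm_pow_sq] at h0
  have h1 := congrArg (Int.cast (R := ℝ)) (h.pairCount_sqrtValue (Or.inl rfl))
  have h3 := congrArg (Int.cast (R := ℝ)) (h.pairCount_sqrtValue (Or.inr rfl))
  have h4 := congrArg (Int.cast (R := ℝ)) h.pairCount_neg_pow
  push_cast at h1 h3 h4
  obtain ⟨r, rfl⟩ : ∃ r, m = d + r := ⟨m - d, by have := h.le; omega⟩
  have a1 : 3 * (d + r) - d = 2 * d + 3 * r := by omega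
  have a2 : 3 * (d + r) - 2 * d = d + 3 * r := by omega
  have a3 : 3 * (d + r) - 3 * d = 3 * r := by omega
  have a4 : 2 * (d + r) - 2 * d = 2 * r := by omega
  rw [a1, a2, a3, a4]
  rw [Nat.add_sub_cancel_left] at h1 h3 h4
  have hp1 : (1 : ℝ) < p := by exact_mod_cast hp.out.one_lt
  have hD : (p : ℝ) ^ d ≠ 0 := by positivity
  have hR : (p : ℝ) ^ r ≠ 0 := by positivity
  have hD1 : ((p : ℝ) ^ d) ^ 2 - 1 ≠ 0 := by
    have : 1 < ((p : ℝ) ^ d) ^ 2 := by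
      rw [← pow_mul]; exact one_lt_pow₀ hp1 (by have := h.pos_common; omega)
    exact (sub_pos.2 this).ne'
  have goal : (tripleCount s σ 0 : ℝ) = ((p : ℝ) ^ (2 * (d + r)) - 1) * ((p : ℝ) ^ (2 * d + 3 * r) -
      (p : ℝ) ^ (d + 3 * r) + (p : ℝ) ^ (3 * r) - (p : ℝ) ^ (2 * r) + 1) := by
    rw [h0]
    clear h0
    have h5 := (eq_div_iff (_root_.two_ne_zero)).2 ((mul_comm _ _).trans h1)
    have h6 := (eq_div_iff (_root_.two_ne_zero)).2 ((mul_comm _ _).trans h3)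
    simp only [pow_add, pow_mul', mul_pow] at h4 h5 h6 ⊢
    rw [h5, h6, (eq_div_iff hD1).2 h4]
    generalize (p : ℝ) ^ d = D at *
    generalize (p : ℝ) ^ r = R at *
    field_simp
    ring
  exact_mod_cast goal

/-- Every sum is zero or a `p`-th root of unity times an untwisted sum. -/
theorem weilSum_eq_zero_or (h : IsTwistPair m d s σ) {α : F} (hα : s α = α) (β γ : F) :
    weilSum s σ α β γ = 0 ∨ ∃ j : ZMod p,
      weilSum s σ α β γ = ZMod.stdAddChar j * weilSum s σ α β 0 := by
  by_cases h0 : weilSum s σ α β γ = 0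
  · exact Or.inl h0
  · obtain ⟨y, rfl⟩ := exists_twistedPolar_eq_of_weilSum_ne_zero h.two_ne_zero h.invol hα β h0
    exact Or.inr ⟨_, weilSum_twistedPolar h.two_ne_zero h.invol hα β y⟩

end IsTwistPair

end TripleMultiplicities

section Frobenius

theorem pow_pow_gcd_eq {M : Type*} [Monoid M] {p : ℕ} {x : M} {a b : ℕ} (ha : x ^ p ^ a = x)
    (hb : x ^ p ^ b = x) :
    x ^ p ^ a.gcd b = x := by
  have hiff : ∀ c, Function.IsPeriodicPt (fun y : M => y ^ p) c x ↔ x ^ p ^ c = x := fun c => by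
    rw [Function.IsPeriodicPt, Function.IsFixedPt, pow_iterate]
  exact (hiff _).1 (((hiff a).2 ha).gcd ((hiff b).2 hb))

theorem pow_pow_eq_of_dvd {M : Type*} [Monoid M] {p : ℕ} {x : M} {a b : ℕ} (ha : x ^ p ^ a = x)
    (hab : a ∣ b) :
    x ^ p ^ b = x := by
  have hiff : ∀ c, Function.IsPeriodicPt (fun y : M => y ^ p) c x ↔ x ^ p ^ c = x := fun c => by
    rw [Function.IsPeriodicPt, Function.IsFixedPt, pow_iterate]
  exact (hiff _).1 (((hiff a).2 ha).trans_dvd hab)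

theorem card_pow_pow_eq {p : ℕ} [hp : Fact p.Prime] {F : Type*} [Field F] [Fintype F] {a N : ℕ}
    (hF : Fintype.card F = p ^ N) (ha : a ∣ N) :
    (Finset.univ.filter fun x : F => x ^ p ^ a = x).card = p ^ a := by
  have h1 : ((Finset.univ.filter fun x : F => x ^ p ^ a = x).erase 0).card = p ^ a - 1 := by
    have h3 := IsCyclic.card_powMonoidHom_ker (G := Fˣ) (p ^ a - 1)
    rw [Nat.card_eq_fintype_card (α := Fˣ), Fintype.card_units, hF,
      Nat.gcd_eq_right (Nat.pow_sub_one_dvd_pow_sub_one _ ha)] at h3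
    rw [← h3, Nat.card_eq_fintype_card, ← Fintype.card_coe]
    have hpos : p ^ a - 1 + 1 = p ^ a := Nat.sub_add_cancel (Nat.one_le_pow _ _ hp.out.pos)
    refine Fintype.card_congr
      { toFun := fun x => ⟨Units.mk0 x (Finset.mem_erase.1 x.2).1, ?_⟩
        invFun := fun u => ⟨((u : Fˣ) : F), ?_⟩
        left_inv := fun x => rfl
        right_inv := fun u => by ext; rfl }
    · obtain ⟨x, hx⟩ := x
      rw [Finset.mem_erase, Finset.mem_filter] at hx
      rw [MonoidHom.mem_ker, powMonoidHom_apply, Units.ext_iff]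
      have h4 := hx.2.2
      rw [← hpos, pow_succ] at h4
      simpa using (mul_eq_right₀ hx.1).1 h4
    · obtain ⟨u, hu⟩ := u
      rw [MonoidHom.mem_ker, powMonoidHom_apply, Units.ext_iff] at hu
      rw [Finset.mem_erase, Finset.mem_filter]
      refine ⟨u.ne_zero, Finset.mem_univ _, show (u : F) ^ p ^ a = u from ?_⟩
      rw [← hpos, pow_succ]
      simp only [Units.val_pow_eq_pow_val, Units.val_one] at hu
      rw [hu, one_mul]
  have h0 : (0 : F) ∈ Finset.univ.filter fun x : F => x ^ p ^ a = x := by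
    simp [hp.out.ne_zero]
  rw [Finset.card_erase_of_mem h0] at h1
  have h5 := Finset.card_pos.2 ⟨_, h0⟩
  have h6 : 1 ≤ p ^ a := Nat.one_le_pow _ _ hp.out.pos
  omega

variable (p : ℕ) [hp : Fact p.Prime] (F : Type*) [Field F] [Fintype F] [Algebra (ZMod p) F]

/-- The `a`-th power of the Frobenius automorphism. -/
def frobPow (a : ℕ) : F ≃ₐ[ZMod p] F :=
  FiniteField.frobeniusAlgEquivOfAlgebraic (ZMod p) F ^ a

variable {p F}

theorem frobPow_apply (a : ℕ) (x : F) : frobPow p F a x = x ^ p ^ a := by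
  rw [frobPow, AlgEquiv.coe_pow, FiniteField.coe_frobeniusAlgEquivOfAlgebraic_iterate, ZMod.card]

theorem isTwistPair_frobPow {m k d : ℕ} (hodd : p % 2 = 1)
    (hd : d = m.gcd k) (hd' : (m + k).gcd (2 * k) = d) (hdodd : d % 2 = 1)
    (hF : Fintype.card F = p ^ (2 * m)) : IsTwistPair m d (frobPow p F m) (frobPow p F k) := by
  have hcard : ∀ x : F, x ^ p ^ (2 * m) = x := fun x => by
    rw [← hF, FiniteField.pow_card]
  have hdm : d ∣ m := hd ▸ Nat.gcd_dvd_left m k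
  have hdk : d ∣ k := hd ▸ Nat.gcd_dvd_right m k
  have hcommon : ∀ x : F, x ^ p ^ k = x ^ p ^ m ↔ x ^ p ^ d = x := by
    intro x
    constructor
    · intro hx
      have h1 : x ^ p ^ (m + k) = x := by
        rw [add_comm, pow_add, pow_mul, hx, ← pow_mul, ← pow_add, ← two_mul, hcard]
      have h3 : x ^ p ^ (2 * k) = x := by
        rw [two_mul, pow_add, pow_mul, hx, ← pow_mul, ← pow_add, h1]
      rw [← hd']
      exact pow_pow_gcd_eq h1 h3
    · intro hx
      rw [pow_pow_eq_of_dvd hx hdk, pow_pow_eq_of_dvd hx hdm]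
  refine ⟨hodd, hdodd, fun x => ?_, fun x => ?_, fun v hs hσ => ?_, hF, ?_, ?_⟩
  · rw [frobPow_apply, frobPow_apply, ← pow_mul, ← pow_add, ← two_mul, hcard]
  · simp only [frobPow_apply, ← pow_mul, mul_comm]
  · have h1 : v ^ p ^ m = v := by
      refine pow_pow_eq_of_dvd ((hcommon v).1 ?_) hdm
      rw [← frobPow_apply, ← frobPow_apply, hs, hσ]
    rw [frobPow_apply, h1, eq_neg_iff_add_eq_zero, ← two_mul] at hs
    exact (mul_eq_zero.1 hs).resolve_left (two_ne_zero_of_odd p F hodd)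
  · simp only [frobPow_apply]
    exact card_pow_pow_eq hF (Dvd.intro_left 2 rfl)
  · simp only [frobPow_apply, hcommon]
    exact card_pow_pow_eq hF (hdm.mul_left 2)

end Frobenius

section ExponentialSums

variable {p : ℕ} [hp : Fact p.Prime] {F : Type} [Field F] [Algebra (ZMod p) F]

theorem fToZMod_algebraMap (c : ZMod p) : fToZMod p (algebraMap (ZMod p) F c) = c := by
  rw [fToZMod]
  exact Function.leftInverse_invFun (algebraMap (ZMod p) F).injective c

variable [Fintype F]

theorem trSum_eq_trace {n : ℕ} (hF : Fintype.card F = p ^ n) (x : F) :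
    trSum p 1 n x = algebraMap (ZMod p) F (Algebra.trace (ZMod p) F x) := by
  have h1 : Module.finrank (ZMod p) F = n := by
    have := FiniteField.pow_finrank_eq_card p F
    rw [hF] at this
    exact Nat.pow_right_injective hp.out.two_le this
  rw [FiniteField.algebraMap_trace_eq_sum_pow, h1, trSum, Nat.card_zmod]
  simp only [one_mul]

theorem trSum_half_eq_trace {m : ℕ} (hodd : p % 2 = 1) (hF : Fintype.card F = p ^ (2 * m)) {y : F}
    (hy : y ^ p ^ m = y) :
    trSum p 1 m y = algebraMap (ZMod p) F (Algebra.trace (ZMod p) F (y / 2)) := by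
  have h2 := two_ne_zero_of_odd p F hodd
  have h1 : trSum p 1 (2 * m) y = 2 * trSum p 1 m y := by
    simp only [trSum, one_mul]
    rw [two_mul m, Finset.sum_range_add, two_mul]
    congr 1
    refine Finset.sum_congr rfl fun i _ => ?_
    rw [pow_add, pow_mul, hy]
  refine mul_left_cancel₀ h2 ?_
  rw [← h1, trSum_eq_trace hF, ← map_ofNat (algebraMap (ZMod p) F) 2, ← map_mul,
    ← smul_eq_mul (2 : ZMod p), ← map_smul, Algebra.smul_def, map_ofNat, mul_div_cancel₀ _ h2]

theorem Ssum_eq_weilSum {m k : ℕ} (hodd : p % 2 = 1) (hF : Fintype.card F = p ^ (2 * m))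
    {α : F} (hα : α ^ p ^ m = α) (β γ : F) :
    Ssum p m (2 * m) k F α β γ = weilSum (frobPow p F m) (frobPow p F k) α β γ := by
  rw [Ssum, weilSum]
  refine Finset.sum_congr rfl fun x _ => ?_
  have hy : (α * x ^ (p ^ m + 1)) ^ p ^ m = α * x ^ (p ^ m + 1) := by
    have hx : x ^ (p ^ m * p ^ m) = x := by
      rw [← pow_add, ← two_mul, ← hF, FiniteField.pow_card]
    rw [mul_pow, hα, pow_succ, mul_pow, ← pow_mul, hx, mul_comm x]
  rw [trSum_half_eq_trace hodd hF hy, trSum_eq_trace hF, fToZMod_algebraMap, fToZMod_algebraMap,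
    expChar_eq_stdAddChar, traceChar_apply, ← map_add]
  congr 2
  rw [twistedForm, frobPow_apply, frobPow_apply]
  ring

theorem Scount_eq_tripleCount {m k : ℕ} (hodd : p % 2 = 1) (hF : Fintype.card F = p ^ (2 * m))
    (v : ℂ) :
    Scount p m (2 * m) k F v = tripleCount (frobPow p F m) (frobPow p F k) v := by
  rw [Scount, tripleCount, Nat.card_eq_fintype_card, Fintype.card_subtype]
  congr 1
  ext abc
  simp only [Finset.mem_filter, Finset.mem_univ, true_and, frobPow_apply]
  exact and_congr_right fun hα => by rw [Ssum_eq_weilSum hodd hF hα]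

theorem zmod_natCast_ne_zero {j : ℕ} (h1 : 1 ≤ j) (h2 : j ≤ p - 1) : (j : ZMod p) ≠ 0 := by
  rw [Ne, ZMod.natCast_eq_zero_iff]
  intro h
  have := Nat.le_of_dvd h1 h
  have := hp.out.pos
  omega

end ExponentialSums

section Values

variable {p : ℕ} [hp : Fact p.Prime]

theorem zmod_eq_zero_or_exists_natCast (c : ZMod p) :
    c = 0 ∨ ∃ j : ℕ, 1 ≤ j ∧ j ≤ p - 1 ∧ (j : ZMod p) = c := by
  by_cases hc : c = 0
  · exact Or.inl hc
  · have h1 := ZMod.val_lt c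
    have h3 := (ZMod.val_ne_zero c).2 hc
    exact Or.inr ⟨c.val, by omega, by omega, ZMod.natCast_zmod_val c⟩

theorem stdAddChar_mul_eq_or (c : ZMod p) (v : ℂ) :
    ZMod.stdAddChar c * v = v ∨
      ∃ j : ℕ, 1 ≤ j ∧ j ≤ p - 1 ∧ ZMod.stdAddChar c * v = zetaC p ^ j * v := by
  rcases zmod_eq_zero_or_exists_natCast c with rfl | ⟨j, h1, h2, rfl⟩
  · exact Or.inl (by rw [AddChar.map_zero_eq_one, one_mul])
  · exact Or.inr ⟨j, h1, h2, by rw [stdAddChar_natCast]⟩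

theorem weilSum_zero_zero {F : Type*} [Field F] [Fintype F] [Algebra (ZMod p) F]
    (s σ : F ≃ₐ[ZMod p] F) (γ : F) :
    weilSum s σ 0 0 γ = 0 ∨ weilSum s σ 0 0 γ = Fintype.card F := by
  have h1 : weilSum s σ 0 0 γ = if γ = 0 then (Fintype.card F : ℂ) else 0 := by
    rw [← sum_traceChar_mul p]
    simp [weilSum, twistedForm]
  rw [h1]
  split_ifs
  · exact Or.inr rfl
  · exact Or.inl rfl

end Values

theorem stmt14 (p m k n d d' : ℕ) [hp : Fact (Nat.Prime p)] (hodd : p % 2 = 1)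
    (hm : 0 < m) (hn : n = 2 * m) (hk : k ≤ n - 1) (hkm : k ≠ m)
    (hd : d = Nat.gcd m k) (hd' : d' = Nat.gcd (m + k) (2 * k))
    (F : Type) [Field F] [Fintype F] [Algebra (ZMod p) F] (hF : Fintype.card F = p ^ n) (hcase : d' = d) (hdodd : d % 2 = 1) :
    (2 * ((p : ℤ) ^ d + 1) * (Scount p m n k F ((p : ℂ) ^ m) : ℤ)
        = (p : ℤ) ^ (m + d - 1) * ((p : ℤ) ^ m + 1) * ((p : ℤ) ^ m + (p : ℤ) - 1)
          * ((p : ℤ) ^ n - 1)) ∧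
    (2 * ((p : ℤ) ^ d - 1) * (Scount p m n k F (-(p : ℂ) ^ m) : ℤ)
        = (p : ℤ) ^ (m + d - 1) * ((p : ℤ) ^ m - 1) * ((p : ℤ) ^ m - (p : ℤ) + 1)
          * ((p : ℤ) ^ n - 2 * (p : ℤ) ^ (n - d) + 1)) ∧
    (∀ j : ℕ, 1 ≤ j → j ≤ p - 1 →
      2 * ((p : ℤ) ^ d + 1) * (Scount p m n k F (zetaC p ^ j * (p : ℂ) ^ m) : ℤ)
        = (p : ℤ) ^ (m + d - 1) * ((p : ℤ) ^ n - 1) ^ 2) ∧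
    (∀ j : ℕ, 1 ≤ j → j ≤ p - 1 →
      2 * ((p : ℤ) ^ d - 1) * (Scount p m n k F (-(zetaC p ^ j * (p : ℂ) ^ m)) : ℤ)
        = (p : ℤ) ^ (m + d - 1) * ((p : ℤ) ^ n - 1)
          * ((p : ℤ) ^ n - 2 * (p : ℤ) ^ (n - d) + 1)) ∧
    (∀ ε : ℤ, ε = 1 ∨ ε = -1 →
      2 * (Scount p m n k F ((ε : ℂ) * sqrtStar p * (p : ℂ) ^ (m + (d - 1) / 2)) : ℤ)
        = (p : ℤ) ^ (3 * m - 2 * d - 1) * ((p : ℤ) ^ n - 1)) ∧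
    (∀ ε : ℤ, ε = 1 ∨ ε = -1 → ∀ j : ℕ, 1 ≤ j → j ≤ p - 1 →
      2 * (Scount p m n k F
            ((ε : ℂ) * zetaC p ^ j * sqrtStar p * (p : ℂ) ^ (m + (d - 1) / 2)) : ℤ)
        = (p : ℤ) ^ (n - (3 * d + 1) / 2)
          * ((p : ℤ) ^ (m - (d + 1) / 2) + ε * legendreSym p (-(j : ℤ)))
          * ((p : ℤ) ^ n - 1)) ∧
    (((p : ℤ) ^ (2 * d) - 1) * (Scount p m n k F (-(p : ℂ) ^ (m + d)) : ℤ)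
        = (p : ℤ) ^ (m - d - 1) * ((p : ℤ) ^ (m - d) - 1) * ((p : ℤ) ^ n - 1)
          * ((p : ℤ) ^ (m - d) - (p : ℤ) + 1)) ∧
    (∀ j : ℕ, 1 ≤ j → j ≤ p - 1 →
      ((p : ℤ) ^ (2 * d) - 1) * (Scount p m n k F (-(zetaC p ^ j * (p : ℂ) ^ (m + d))) : ℤ)
        = (p : ℤ) ^ (m - d - 1) * ((p : ℤ) ^ (n - 2 * d) - 1) * ((p : ℤ) ^ n - 1)) ∧
    ((Scount p m n k F 0 : ℤ)
        = ((p : ℤ) ^ n - 1) * ((p : ℤ) ^ (3 * m - d) - (p : ℤ) ^ (3 * m - 2 * d)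
            + (p : ℤ) ^ (3 * m - 3 * d) - (p : ℤ) ^ (n - 2 * d) + 1)) ∧
    (Scount p m n k F ((p : ℂ) ^ n) = 1) ∧
    (∀ α β γ : F, α ^ p ^ m = α →
      Ssum p m n k F α β γ = (p : ℂ) ^ m ∨
      Ssum p m n k F α β γ = -(p : ℂ) ^ m ∨
      (∃ j : ℕ, 1 ≤ j ∧ j ≤ p - 1 ∧ Ssum p m n k F α β γ = zetaC p ^ j * (p : ℂ) ^ m) ∨
      (∃ j : ℕ, 1 ≤ j ∧ j ≤ p - 1 ∧ Ssum p m n k F α β γ = -(zetaC p ^ j * (p : ℂ) ^ m)) ∨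
      (∃ ε : ℤ, (ε = 1 ∨ ε = -1) ∧
        Ssum p m n k F α β γ = (ε : ℂ) * sqrtStar p * (p : ℂ) ^ (m + (d - 1) / 2)) ∨
      (∃ ε : ℤ, (ε = 1 ∨ ε = -1) ∧ ∃ j : ℕ, 1 ≤ j ∧ j ≤ p - 1 ∧
        Ssum p m n k F α β γ = (ε : ℂ) * zetaC p ^ j * sqrtStar p * (p : ℂ) ^ (m + (d - 1) / 2)) ∨
      Ssum p m n k F α β γ = -(p : ℂ) ^ (m + d) ∨
      (∃ j : ℕ, 1 ≤ j ∧ j ≤ p - 1 ∧ Ssum p m n k F α β γ = -(zetaC p ^ j * (p : ℂ) ^ (m + d))) ∨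
      Ssum p m n k F α β γ = 0 ∨
      Ssum p m n k F α β γ = (p : ℂ) ^ n) := by
  subst hn
  have hdd : (m + k).gcd (2 * k) = d := hd'.symm.trans hcase
  have h := isTwistPair_frobPow hodd hd hdd hdodd hF
  obtain ⟨t, r, ht, hr⟩ := h.exists_eq_add
  simp only [Scount_eq_tripleCount hodd hF]
  refine ⟨?_, ?_, fun j hj1 hj2 => ?_, fun j hj1 hj2 => ?_, fun ε hε => ?_,
    fun ε hε j hj1 hj2 => ?_, ?_, fun j hj1 hj2 => ?_, h.tripleCount_zero,
    h.tripleCount_pow_two_mul,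
    fun α β γ hα => ?_⟩
  · have h1 := h.tripleCount_pow 0
    rw [AddChar.map_zero_eq_one, one_mul, if_pos rfl] at h1
    rw [h1]
    ring
  · have h1 := h.tripleCount_neg_pow_self 0
    rw [AddChar.map_zero_eq_one, one_mul, if_pos rfl] at h1
    rw [h1]
    ring
  · have h1 := h.tripleCount_pow j
    rw [stdAddChar_natCast, if_neg (zmod_natCast_ne_zero hj1 hj2)] at h1
    rw [h1]
    ring
  · have h1 := h.tripleCount_neg_pow_self j
    rw [stdAddChar_natCast, if_neg (zmod_natCast_ne_zero hj1 hj2), mul_neg] at h1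
    rw [h1]
    ring
  · have h1 := h.tripleCount_sqrtValue hε 0
    rw [AddChar.map_zero_eq_one, one_mul, neg_zero, MulChar.map_zero, mul_zero, add_zero,
      ← pow_add] at h1
    rw [← sqrtValue, h1]
    congr 2
    omega
  · have h1 := h.tripleCount_sqrtValue hε j
    have h3 : (ε : ℂ) * zetaC p ^ j * sqrtStar p * (p : ℂ) ^ (m + (d - 1) / 2) =
        zetaC p ^ j * sqrtValue p m d ε := by
      rw [sqrtValue]
      ring
    rw [h3, ← stdAddChar_natCast, h1, legendreSym, Int.cast_neg, Int.cast_natCast]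
  · have h1 := h.tripleCount_neg_pow 0
    rw [AddChar.map_zero_eq_one, one_mul, if_pos rfl] at h1
    rw [h1]
    ring
  · have h1 := h.tripleCount_neg_pow j
    have h3 : (p : ℤ) ^ (2 * m - 2 * d) = (p : ℤ) ^ (m - d) * (p : ℤ) ^ (m - d) := by
      rw [← pow_add]
      congr 1
      omega
    rw [stdAddChar_natCast, if_neg (zmod_natCast_ne_zero hj1 hj2), mul_neg] at h1
    rw [h1, h3]
    ring
  · have hα' : frobPow p F m α = α := by rw [frobPow_apply, hα]
    rw [Ssum_eq_weilSum hodd hF hα]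
    rcases h.weilSum_eq_zero_or hα' β γ with h0 | ⟨c, hc⟩
    · tauto
    have hsqrt : ∀ (ε : ℤ) (j : ℕ), zetaC p ^ j * sqrtValue p m d ε =
        (ε : ℂ) * zetaC p ^ j * sqrtStar p * (p : ℂ) ^ (m + (d - 1) / 2) := fun ε j => by
      rw [sqrtValue]
      ring
    have key := stdAddChar_mul_eq_or c (weilSum (frobPow p F m) (frobPow p F k) α β 0)
    rw [← hc] at key
    rcases h.weilSum_cases hα' β with hT | hT | hT | hT | hT | ⟨hab, -⟩
    · rw [hT] at key
      rcases key with hv | hv <;> simp only [hv, true_or, or_true]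
    · simp only [hT, mul_neg] at key
      rcases key with hv | hv <;> simp only [hv, true_or, or_true]
    · simp only [hT, hsqrt] at key
      have := Or.inl (b := (1 : ℤ) = -1) (Eq.refl (1 : ℤ))
      rcases key with hv | hv
      · exact Or.inr (Or.inr (Or.inr (Or.inr (Or.inl ⟨1, this, hv⟩))))
      · exact Or.inr (Or.inr (Or.inr (Or.inr (Or.inr (Or.inl ⟨1, this, hv⟩)))))
    · simp only [hT, hsqrt] at key
      have := Or.inr (a := (-1 : ℤ) = 1) (Eq.refl (-1 : ℤ))
      rcases key with hv | hv
      · exact Or.inr (Or.inr (Or.inr (Or.inr (Or.inl ⟨-1, this, hv⟩))))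
      · exact Or.inr (Or.inr (Or.inr (Or.inr (Or.inr (Or.inl ⟨-1, this, hv⟩)))))
    · simp only [hT, mul_neg] at key
      rcases key with hv | hv <;> simp only [hv, true_or, or_true]
    · obtain ⟨rfl, rfl⟩ := Prod.mk.inj hab
      have h1 := weilSum_zero_zero (frobPow p F m) (frobPow p F k) γ
      rw [hF, Nat.cast_pow] at h1
      tauto
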